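/- Let Ω ⊆ 𝔻 be an open connected set and {u_k} a sequence of minimal graphs on Ω with divergence set 𝒟. Then 𝒟 is a (possibly empty) union of geodesic arcs contained in Ω (called divergence lines), each of which is closed as a subset of Ω and has both of its endpoints in ∂Ω ∪ ∂∞𝔻 (possibly at vertices of Ω or at ideal points). -/

import Mathlib

noncomputable section

open Filter MeasureTheory Set Topology
open scoped RealInnerProductSpace Topology

/-- The Euclidean plane, as a Euclidean space. -/
abbrev E2 : Type := EuclideanSpace ℝ (Fin 2)

/-- The Poincaré disk. -/
def Disk : Set E2 := {p : E2 | ‖p‖ < 1}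

/-- Conformal factor of the hyperbolic metric. -/
def lam (p : E2) : ℝ := 2 / (1 - ‖p‖ ^ 2)

/-- Inverse hyperbolic cosine. -/
def arcosh (x : ℝ) : ℝ := Real.log (x + Real.sqrt (x ^ 2 - 1))

/-- Hyperbolic distance on the Poincaré disk. -/
def hDist (p q : E2) : ℝ :=
  arcosh (1 + 2 * ‖p - q‖ ^ 2 / ((1 - ‖p‖ ^ 2) * (1 - ‖q‖ ^ 2)))

/-- Hyperbolic distance from a point to a set. -/
def hDistSet (a : E2) (S : Set E2) : ℝ := sInf (hDist a '' S)

/-- Hyperbolic length of a subset of the disk, via the 1-dimensional Hausdorff measure. -/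
def hLen (S : Set E2) : ℝ := ∫ p in S, lam p ∂(μH[1])

/-- Hyperbolic length of a parametrized curve. -/
def hLength (γ : ℝ → E2) (a b : ℝ) : ℝ := ∫ t in a..b, lam (γ t) * ‖deriv γ t‖

/-- The Poincaré-to-Klein point transfer map. -/
def toKlein (p : E2) : E2 := (2 / (1 + ‖p‖ ^ 2)) • p

/-- The geodesic arc of the Poincaré disk joining two points of the closed disk:
the preimage in the disk of the Euclidean segment joining the corresponding Klein-model
points.  (It contains its endpoints when these are interior, and an ideal endpoint is
automatically excluded.) -/
def geodArc (a b : E2) : Set E2 :=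
  {p : E2 | p ∈ Disk ∧ ∃ t ∈ Icc (0:ℝ) 1, toKlein p = (1 - t) • toKlein a + t • toKlein b}

/-- Hyperbolic convexity. -/
def HypConvex (S : Set E2) : Prop := ∀ a ∈ S, ∀ b ∈ S, geodArc a b ⊆ S

/-- The open hyperbolic disk of radius `R` centered at the origin. -/
def hBall (R : ℝ) : Set E2 := {p ∈ Disk | hDist 0 p < R}

/-- The normalized horizontal projection of the downward normal of the graph of `u`:
`X_u = ∇₀u / √(1 + λ⁻²·|∇₀u|²)`. -/
def Xfield (u : E2 → ℝ) (p : E2) : E2 :=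
  (Real.sqrt (1 + ((lam p)⁻¹) ^ 2 * ‖gradient u p‖ ^ 2))⁻¹ • gradient u p

/-- Euclidean divergence of a planar vector field. -/
def div0 (X : E2 → E2) (p : E2) : ℝ :=
  ∑ i : Fin 2, fderiv ℝ X p (EuclideanSpace.single i 1) i

/-- `u` is a minimal graph on `Ω`: smooth and satisfying the minimal surface equation
`div₀(∇₀u / √(1 + λ⁻²·|∇₀u|²)) = 0`. -/
def IsMinimalGraph (Ω : Set E2) (u : E2 → ℝ) : Prop :=
  ContDiffOn ℝ (⊤ : ℕ∞) u Ω ∧ ∀ p ∈ Ω, div0 (Xfield u) p = 0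

/-- Rotation by `-90°`, turning a tangent vector into a normal vector of the same length. -/
def Jrot (v : E2) : E2 :=
  v 1 • EuclideanSpace.single (0 : Fin 2) (1:ℝ) - v 0 • EuclideanSpace.single (1 : Fin 2) (1:ℝ)

/-- Flux of the vector field `X` along the curve `γ : [a,b] → E2`, with respect to the
normal `Jrot (γ')`:  `∫ ⟨X, η₀⟩ ds₀`. -/
def fluxV (X : E2 → E2) (γ : ℝ → E2) (a b : ℝ) : ℝ :=
  ∫ t in a..b, ⟪X (γ t), Jrot (deriv γ t)⟫

/-- A piecewise `C¹` curve on `[a,b]`. -/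
def PiecewiseC1On (γ : ℝ → E2) (a b : ℝ) : Prop :=
  ContinuousOn γ (Icc a b) ∧
  ∃ s : Finset ℝ, ∀ t ∈ Icc a b, t ∉ s → DifferentiableAt ℝ γ t ∧ ContinuousAt (deriv γ) t

/-- `η` points outward from `Ω` at the boundary point `x`. -/
def OutwardNormalAt (Ω : Set E2) (x η : E2) : Prop :=
  ∀ᶠ ε : ℝ in 𝓝[>] (0:ℝ), x - ε • η ∈ Ω ∧ x + ε • η ∉ closure Ω

/-- A horocycle at an ideal point: a Euclidean circle tangent to the unit circle
from inside at `pt`, with Euclidean radius `r`. -/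
structure Horocycle where
  pt : E2
  r : ℝ
  hpt : ‖pt‖ = 1
  hr0 : 0 < r
  hr1 : r < 1

/-- The horocycle as a subset of the disk (the circle itself). -/
def Horocycle.circle (H : Horocycle) : Set E2 := {p : E2 | ‖p - (1 - H.r) • H.pt‖ = H.r}

/-- The open horodisk bounded by a horocycle. -/
def Horocycle.horodisk (H : Horocycle) : Set E2 := {p : E2 | ‖p - (1 - H.r) • H.pt‖ < H.r}

/-- A semi-ideal polygonal domain with `k` ideal vertices `pI i` and `k` interior
vertices `pB i`, cyclically ordered as `pI 0, pB 0, pI 1, pB 1, …`; its edges are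
`A i = geodArc (pI i) (pB i)` and `B i = geodArc (pB i) (pI (i+1))`, and its boundary
inside the disk is exactly the union of the edges. -/
structure SemiIdealDomain (k : ℕ) where
  Ω : Set E2
  pI : ZMod k → E2
  pB : ZMod k → E2
  k_pos : 0 < k
  isOpen : IsOpen Ω
  conn : IsConnected Ω
  subset : Ω ⊆ Disk
  ideal : ∀ i, ‖pI i‖ = 1
  inter : ∀ i, pB i ∈ Disk
  injI : Function.Injective pI
  injB : Function.Injective pB
  boundary : frontier Ω ∩ Disk =
    (⋃ i, geodArc (pI i) (pB i)) ∪ (⋃ i, geodArc (pB i) (pI (i + 1)))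

/-- The edge `A i` of a semi-ideal domain. -/
def SemiIdealDomain.edgeA {k : ℕ} (D : SemiIdealDomain k) (i : ZMod k) : Set E2 :=
  geodArc (D.pI i) (D.pB i)

/-- The edge `B i` of a semi-ideal domain. -/
def SemiIdealDomain.edgeB {k : ℕ} (D : SemiIdealDomain k) (i : ZMod k) : Set E2 :=
  geodArc (D.pB i) (D.pI (i + 1))

/-- The open edge `A i` (without its endpoints). -/
def SemiIdealDomain.intEdgeA {k : ℕ} (D : SemiIdealDomain k) (i : ZMod k) : Set E2 :=
  D.edgeA i \ {D.pI i, D.pB i}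

/-- The open edge `B i` (without its endpoints). -/
def SemiIdealDomain.intEdgeB {k : ℕ} (D : SemiIdealDomain k) (i : ZMod k) : Set E2 :=
  D.edgeB i \ {D.pB i, D.pI (i + 1)}

/-- A general polygonal domain in the Poincaré disk, with cyclically ordered
vertices `q j` (interior or ideal) and geodesic edges. -/
structure PolygonalDomain where
  P : Set E2
  m : ℕ
  q : ZMod m → E2
  m_pos : 0 < m
  isOpen : IsOpen P
  conn : IsConnected P
  subset : P ⊆ Disk
  vtx : ∀ j, ‖q j‖ ≤ 1
  boundary : frontier P ∩ Disk = ⋃ j, geodArc (q j) (q (j + 1))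

/-- A polygonal domain inscribed in a semi-ideal domain: contained in it and all of its
vertices are vertices of the ambient domain. -/
def InscribedIn {k : ℕ} (Q : PolygonalDomain) (D : SemiIdealDomain k) : Prop :=
  Q.P ⊆ D.Ω ∧ ∀ j, Q.q j ∈ Set.range D.pI ∪ Set.range D.pB

/-- `Γ(𝒫)`: the part of `∂𝒫` (inside the disk) lying outside the horodisks. -/
def GammaSet {k : ℕ} (Q : PolygonalDomain) (H : ZMod k → Horocycle) : Set E2 :=
  (frontier Q.P ∩ Disk) \ ⋃ i, (H i).horodisk

/-- `|Γ(𝒫)|`. -/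
def gammaLen {k : ℕ} (Q : PolygonalDomain) (H : ZMod k → Horocycle) : ℝ :=
  hLen (GammaSet Q H)

/-- `α(𝒫) = Σ_i |A_i ∩ Γ(𝒫)|`. -/
def alphaVal {k : ℕ} (D : SemiIdealDomain k) (H : ZMod k → Horocycle)
    (Q : PolygonalDomain) : ℝ :=
  letI : NeZero k := ⟨D.k_pos.ne'⟩
  ∑ i : ZMod k, hLen (D.edgeA i ∩ GammaSet Q H)

/-- `β(𝒫) = Σ_i |B_i ∩ Γ(𝒫)|`. -/
def betaVal {k : ℕ} (D : SemiIdealDomain k) (H : ZMod k → Horocycle)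
    (Q : PolygonalDomain) : ℝ :=
  letI : NeZero k := ⟨D.k_pos.ne'⟩
  ∑ i : ZMod k, hLen (D.edgeB i ∩ GammaSet Q H)

/-- An admissible domain. -/
def Admissible {k : ℕ} (D : SemiIdealDomain k) : Prop :=
  HypConvex D.Ω ∧
  ∃ H : ZMod k → Horocycle,
    (∀ i, (H i).pt = D.pI i) ∧
    (∀ i j, i ≠ j → Disjoint (H i).circle (H j).circle) ∧
    (∀ i, hDistSet (D.pB (i - 1)) (H i).circle = hDistSet (D.pB i) (H i).circle) ∧
    (∀ Q : PolygonalDomain, InscribedIn Q D → Q.P ≠ D.Ω →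
      2 * alphaVal D H Q < gammaLen Q H ∧ 2 * betaVal D H Q < gammaLen Q H)

/-- The Jenkins–Serrin boundary conditions: `u → +∞` on the interior of each edge `A i`,
and `u → −∞` on the interior of each edge `B i`. -/
def JSBoundary {k : ℕ} (D : SemiIdealDomain k) (u : E2 → ℝ) : Prop :=
  (∀ i, ∀ x ∈ D.intEdgeA i, Tendsto u (𝓝[D.Ω] x) atTop) ∧
  (∀ i, ∀ x ∈ D.intEdgeB i, Tendsto u (𝓝[D.Ω] x) atBot)

/-- An admissible pair. -/
def AdmissiblePair {k : ℕ} (D : SemiIdealDomain k) (u : E2 → ℝ) : Prop :=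
  Admissible D ∧ (0 : E2) ∈ D.Ω ∧ u 0 = 0 ∧ IsMinimalGraph D.Ω u ∧ JSBoundary D u

/-- The divergence set of a sequence of minimal graphs. -/
def DivergenceSet (Ω : Set E2) (u : ℕ → E2 → ℝ) : Set E2 :=
  {p ∈ Ω | ¬ ∃ C : ℝ, ∀ k, ‖gradient (u k) p‖ ≤ C}

open scoped ContDiff

/-! ### Derivatives along vector fields -/

/-- The first vector of the standard basis of the plane. -/
def ex : E2 := EuclideanSpace.single 0 1

/-- The second vector of the standard basis of the plane. -/
def ey : E2 := EuclideanSpace.single 1 1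

@[simp] lemma ex_zero : ex 0 = 1 := by simp [ex]
@[simp] lemma ex_one : ex 1 = 0 := by simp [ex]
@[simp] lemma ey_zero : ey 0 = 0 := by simp [ey]
@[simp] lemma ey_one : ey 1 = 1 := by simp [ey]

lemma eq_coord (v : E2) : v = v 0 • ex + v 1 • ey := by
  ext i; fin_cases i <;> simp

lemma norm_sq_coord (v : E2) : ‖v‖ ^ 2 = v 0 ^ 2 + v 1 ^ 2 := by
  rw [EuclideanSpace.norm_sq_eq]; simp

lemma hasDerivAt_line {f : E2 → ℝ} {z : E2} (hf : DifferentiableAt ℝ f z) (v : E2) :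
    HasDerivAt (fun t : ℝ => f (z + t • v)) (fderiv ℝ f z v) 0 := by
  have h1 : HasDerivAt (fun t : ℝ => z + t • v) v 0 := by
    simpa using ((hasDerivAt_id (0 : ℝ)).smul_const v).const_add z
  have h2 : HasFDerivAt f (fderiv ℝ f z) (z + (0 : ℝ) • v) := by simpa using hf.hasFDerivAt
  exact h2.comp_hasDerivAt (0 : ℝ) h1

lemma fderiv_eq_of_hasDerivAt_line {f : E2 → ℝ} {z v : E2} {d : ℝ}
    (hf : DifferentiableAt ℝ f z) (h : HasDerivAt (fun t : ℝ => f (z + t • v)) d 0) :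
    fderiv ℝ f z v = d :=
  (hasDerivAt_line hf v).unique h

lemma hasDerivAt_coord (z v : E2) (i : Fin 2) :
    HasDerivAt (fun t : ℝ => (z + t • v) i) (v i) 0 := by
  simpa using ((hasDerivAt_id (0 : ℝ)).mul_const (v i)).const_add (z i)

lemma fderiv_coord (z v : E2) (i : Fin 2) : fderiv ℝ (fun x : E2 => x i) z v = v i :=
  fderiv_eq_of_hasDerivAt_line (by fun_prop) (hasDerivAt_coord z v i)

/-- The derivative of `f` along the vector field `V`. -/
def dirD (V : E2 → E2) (f : E2 → ℝ) (z : E2) : ℝ := fderiv ℝ f z (V z)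

lemma dirD_congr {V : E2 → E2} {f g : E2 → ℝ} {U : Set E2} (hU : IsOpen U) {z : E2} (hz : z ∈ U)
    (h : ∀ x ∈ U, f x = g x) : dirD V f z = dirD V g z := by
  have : f =ᶠ[𝓝 z] g := Filter.eventuallyEq_of_mem (hU.mem_nhds hz) h
  rw [dirD, dirD, this.fderiv_eq]

lemma ContDiffOn.dirD {V : E2 → E2} {f : E2 → ℝ} {U : Set E2} (hU : IsOpen U)
    (hV : ContDiffOn ℝ ∞ V U) (hf : ContDiffOn ℝ ∞ f U) : ContDiffOn ℝ ∞ (dirD V f) U :=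
  (hf.fderiv_of_isOpen hU (by simp)).clm_apply hV

lemma ContDiffOn.diffAt {F : Type*} [NormedAddCommGroup F] [NormedSpace ℝ F]
    {f : E2 → F} {U : Set E2} (hU : IsOpen U) (hf : ContDiffOn ℝ ∞ f U)
    {z : E2} (hz : z ∈ U) : DifferentiableAt ℝ f z :=
  (hf.contDiffAt (hU.mem_nhds hz)).differentiableAt (by simp)

lemma dirD_dirD {V W : E2 → E2} {f : E2 → ℝ} {U : Set E2} (hU : IsOpen U)
    (hW : ContDiffOn ℝ ∞ W U) (hf : ContDiffOn ℝ ∞ f U)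
    {z : E2} (hz : z ∈ U) :
    dirD V (dirD W f) z =
      fderiv ℝ (fderiv ℝ f) z (V z) (W z) + fderiv ℝ f z (fderiv ℝ W z (V z)) := by
  have h1 : DifferentiableAt ℝ (fderiv ℝ f) z :=
    ContDiffOn.diffAt hU (hf.fderiv_of_isOpen hU (by simp)) hz
  have h2 := ContDiffOn.diffAt hU hW hz
  have := (h1.hasFDerivAt.clm_apply h2.hasFDerivAt).fderiv
  change fderiv ℝ (fun x => fderiv ℝ f x (W x)) z (V z) = _
  rw [this]
  simp [add_comm]

lemma fderiv_coord_comp {W : E2 → E2} {z : E2} (hW : DifferentiableAt ℝ W z) (v : E2)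
    (i : Fin 2) : fderiv ℝ W z v i = fderiv ℝ (fun x => W x i) z v := by
  have := ((EuclideanSpace.proj i : E2 →L[ℝ] ℝ).hasFDerivAt.comp z
    hW.hasFDerivAt).fderiv
  change _ = fderiv ℝ ((EuclideanSpace.proj i : E2 →L[ℝ] ℝ) ∘ W) z v
  rw [this]; simp

lemma dirD_comm {V W : E2 → E2} {f : E2 → ℝ} {U : Set E2} (hU : IsOpen U)
    (hV : ContDiffOn ℝ ∞ V U) (hW : ContDiffOn ℝ ∞ W U) (hf : ContDiffOn ℝ ∞ f U)
    {z : E2} (hz : z ∈ U)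
    (h : ∀ i, dirD V (fun x => W x i) z = dirD W (fun x => V x i) z) :
    dirD V (dirD W f) z = dirD W (dirD V f) z := by
  rw [dirD_dirD hU hW hf hz, dirD_dirD hU hV hf hz]
  have hs : IsSymmSndFDerivAt ℝ f z :=
    (hf.contDiffAt (hU.mem_nhds hz)).isSymmSndFDerivAt
      (by simpa using WithTop.coe_le_coe.2 (le_top : (2 : ℕ∞) ≤ ⊤))
  have : fderiv ℝ W z (V z) = fderiv ℝ V z (W z) := by
    ext i
    rw [fderiv_coord_comp (ContDiffOn.diffAt hU hW hz),
      fderiv_coord_comp (ContDiffOn.diffAt hU hV hz)]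
    exact h i
  rw [this, hs.eq]

lemma IsLocalMax.dirD_eq_zero {V : E2 → E2} {f : E2 → ℝ} {z : E2} (h : IsLocalMax f z) :
    dirD V f z = 0 := by
  simp [dirD, h.fderiv_eq_zero]

/-- At an interior maximum, second derivatives along a vector field are nonpositive. -/
lemma IsLocalMax.dirD_dirD_nonpos {V : E2 → E2} {f : E2 → ℝ} {U : Set E2} (hU : IsOpen U)
    (hV : ContDiffOn ℝ ∞ V U) (hf : ContDiffOn ℝ ∞ f U) {z : E2} (hz : z ∈ U)
    (h : IsLocalMax f z) : dirD V (dirD V f) z ≤ 0 := by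
  rw [dirD_dirD hU hV hf hz, h.fderiv_eq_zero]
  simp only [_root_.zero_apply, add_zero]
  set v := V z
  by_contra! hpos
  set g : ℝ → ℝ := fun t => f (z + t • v) with hg
  have hline : Continuous (fun t : ℝ => z + t • v) := by fun_prop
  have hnear : ∀ᶠ t in 𝓝 (0 : ℝ), z + t • v ∈ U :=
    hline.continuousAt.eventually_mem (by simpa using hU.mem_nhds hz)
  have hderiv : deriv g =ᶠ[𝓝 0] fun t => fderiv ℝ f (z + t • v) v := by
    filter_upwards [hnear] with t ht
    have h1 : HasDerivAt (fun s : ℝ => z + s • v) v t := by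
      simpa using ((hasDerivAt_id t).smul_const v).const_add z
    exact ((ContDiffOn.diffAt hU hf ht).hasFDerivAt.comp_hasDerivAt t h1).deriv
  have h2 : HasDerivAt (fun t : ℝ => fderiv ℝ f (z + t • v) v) (fderiv ℝ (fderiv ℝ f) z v v) 0 := by
    have h1 : DifferentiableAt ℝ (fderiv ℝ f) z :=
      ContDiffOn.diffAt hU (hf.fderiv_of_isOpen hU (by simp)) hz
    have h3 := hasDerivAt_line (f := fun x => fderiv ℝ f x v) (z := z)
      (h1.clm_apply (differentiableAt_const v)) v
    convert h3 using 1
    rw [(h1.hasFDerivAt.clm_apply (hasFDerivAt_const v z)).fderiv]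
    simp
  have hd2 : deriv (deriv g) 0 = fderiv ℝ (fderiv ℝ f) z v v := by
    rw [hderiv.deriv_eq, h2.deriv]
  have hd1 : deriv g 0 = 0 := by
    rw [hderiv.eq_of_nhds]; simp [h.fderiv_eq_zero]
  have hgc : ContinuousAt g 0 := by
    refine ContinuousAt.comp (g := f) ?_ hline.continuousAt
    simpa using (ContDiffOn.diffAt hU hf hz).continuousAt
  have hmin : IsLocalMin g 0 := isLocalMin_of_deriv_deriv_pos (hd2 ▸ hpos) hd1 hgc
  have hmax : IsLocalMax g 0 := by
    have h5 : Tendsto (fun t : ℝ => z + t • v) (𝓝 0) (𝓝 z) := by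
      simpa using hline.tendsto 0
    have := h5.eventually h
    filter_upwards [this] with t ht
    simpa [hg] using ht
  have hconst : g =ᶠ[𝓝 0] fun _ => g 0 := by
    filter_upwards [hmin, hmax] with t h1 h2
    exact le_antisymm h2 h1
  have : deriv g =ᶠ[𝓝 0] fun _ => 0 := by
    simpa using hconst.deriv
  have h6 := this.deriv_eq
  rw [hd2] at h6
  simp at h6
  linarith

/-! ### Frames adapted to a minimal graph -/

/-- The inverse of the conformal factor of the disk. -/
def mu (z : E2) : ℝ := (1 - (z 0 ^ 2 + z 1 ^ 2)) / 2

lemma contDiff_mu : ContDiff ℝ ∞ mu := by unfold mu; fun_prop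

lemma mu_eq (z : E2) : mu z = (lam z)⁻¹ := by
  rw [lam, mu, norm_sq_coord, inv_div]

lemma mu_pos {z : E2} (hz : ‖z‖ < 1) : 0 < mu z := by
  have := norm_sq_coord z
  have h2 : ‖z‖ ^ 2 < 1 := by nlinarith [norm_nonneg z]
  rw [mu]; linarith

lemma mu_le (z : E2) : mu z ≤ 1 / 2 := by
  rw [mu]; nlinarith [sq_nonneg (z 0), sq_nonneg (z 1)]

lemma fderiv_mu (z v : E2) : fderiv ℝ mu z v = -(z 0 * v 0 + z 1 * v 1) := by
  refine fderiv_eq_of_hasDerivAt_line ((contDiff_mu.differentiable (by simp)) z) ?_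
  have h0 := hasDerivAt_coord z v 0
  have h1 := hasDerivAt_coord z v 1
  refine HasDerivAt.congr_deriv ((((h0.pow 2).add (h1.pow 2)).const_sub 1).div_const 2) ?_
  simp; ring

/-- The vector field dual to the differential of the height function. -/
def frU (om a b : E2 → ℝ) (z : E2) : E2 :=
  (mu z * Real.sinh (om z) * a z) • ex + (mu z * Real.sinh (om z) * b z) • ey

/-- The vector field dual to the differential of the conjugate height function. -/
def frC (om a b : E2 → ℝ) (z : E2) : E2 :=
  (-(mu z * Real.cosh (om z) * b z)) • ex + (mu z * Real.cosh (om z) * a z) • ey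

@[simp] lemma frU_zero (om a b : E2 → ℝ) (z : E2) :
    frU om a b z 0 = mu z * Real.sinh (om z) * a z := by simp [frU]
@[simp] lemma frU_one (om a b : E2 → ℝ) (z : E2) :
    frU om a b z 1 = mu z * Real.sinh (om z) * b z := by simp [frU]
@[simp] lemma frC_zero (om a b : E2 → ℝ) (z : E2) :
    frC om a b z 0 = -(mu z * Real.cosh (om z) * b z) := by simp [frC]
@[simp] lemma frC_one (om a b : E2 → ℝ) (z : E2) :
    frC om a b z 1 = mu z * Real.cosh (om z) * a z := by simp [frC]

lemma contDiffOn_frU {U : Set E2} {om a b : E2 → ℝ} (h2 : ContDiffOn ℝ ∞ om U)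
    (h3 : ContDiffOn ℝ ∞ a U) (h4 : ContDiffOn ℝ ∞ b U) : ContDiffOn ℝ ∞ (frU om a b) U := by
  have h1 := contDiff_mu.contDiffOn (s := U)
  have h5 : ContDiffOn ℝ ∞ (fun z => Real.sinh (om z)) U := h2.sinh
  exact (((h1.mul h5).mul h3).smul contDiffOn_const).add
    (((h1.mul h5).mul h4).smul contDiffOn_const)

lemma contDiffOn_frC {U : Set E2} {om a b : E2 → ℝ} (h2 : ContDiffOn ℝ ∞ om U)
    (h3 : ContDiffOn ℝ ∞ a U) (h4 : ContDiffOn ℝ ∞ b U) : ContDiffOn ℝ ∞ (frC om a b) U := by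
  have h1 := contDiff_mu.contDiffOn (s := U)
  have h5 : ContDiffOn ℝ ∞ (fun z => Real.cosh (om z)) U := h2.cosh
  exact (((h1.mul h5).mul h4).neg.smul contDiffOn_const).add
    (((h1.mul h5).mul h3).smul contDiffOn_const)

/-- A function `om > 0` and a unit field `(a, b)` whose associated vector fields commute. For a
minimal graph `u`, these are `arsinh` of the inverse hyperbolic slope and the direction
of the gradient. -/
structure MinFrame (U : Set E2) (om a b : E2 → ℝ) : Prop where
  isOpen : IsOpen U
  sub : ∀ z ∈ U, ‖z‖ < 1
  smooth_om : ContDiffOn ℝ ∞ om U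
  smooth_a : ContDiffOn ℝ ∞ a U
  smooth_b : ContDiffOn ℝ ∞ b U
  pos : ∀ z ∈ U, 0 < om z
  unit : ∀ z ∈ U, a z ^ 2 + b z ^ 2 = 1
  comm : ∀ z ∈ U, ∀ i, dirD (frU om a b) (fun x => frC om a b x i) z =
    dirD (frC om a b) (fun x => frU om a b x i) z

namespace MinFrame

variable {U : Set E2} {om a b : E2 → ℝ}

lemma smooth_frU (h : MinFrame U om a b) : ContDiffOn ℝ ∞ (frU om a b) U :=
  contDiffOn_frU h.smooth_om h.smooth_a h.smooth_b

lemma smooth_frC (h : MinFrame U om a b) : ContDiffOn ℝ ∞ (frC om a b) U :=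
  contDiffOn_frC h.smooth_om h.smooth_a h.smooth_b

lemma dirD_unit (h : MinFrame U om a b) {z : E2} (hz : z ∈ U) (V : E2 → E2) :
    a z * dirD V a z + b z * dirD V b z = 0 := by
  have ha := hasDerivAt_line (ContDiffOn.diffAt h.isOpen h.smooth_a hz) (V z)
  have hb := hasDerivAt_line (ContDiffOn.diffAt h.isOpen h.smooth_b hz) (V z)
  have h1 := (ha.pow 2).add (hb.pow 2)
  have hline : Continuous (fun t : ℝ => z + t • V z) := by fun_prop
  have hnear : ∀ᶠ t in 𝓝 (0 : ℝ), z + t • V z ∈ U :=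
    hline.continuousAt.eventually_mem (by simpa using h.isOpen.mem_nhds hz)
  have h2 : HasDerivAt (fun t : ℝ => a (z + t • V z) ^ 2 + b (z + t • V z) ^ 2) 0 0 := by
    refine (hasDerivAt_const (0 : ℝ) (1 : ℝ)).congr_of_eventuallyEq ?_
    filter_upwards [hnear] with t ht using h.unit _ ht
  have := h1.unique h2
  simp at this
  simp only [dirD]
  linarith

/-- The derivative of the angle of the unit field along `V`. -/
def turn (V : E2 → E2) (a b : E2 → ℝ) (z : E2) : ℝ := a z * dirD V b z - b z * dirD V a z

lemma dirD_a (h : MinFrame U om a b) {z : E2} (hz : z ∈ U) (V : E2 → E2) :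
    dirD V a z = -(turn V a b z * b z) := by
  have h1 := h.dirD_unit hz V
  have h2 := h.unit z hz
  rw [turn]
  linear_combination (-dirD V a z) * h2 + a z * h1

lemma dirD_b (h : MinFrame U om a b) {z : E2} (hz : z ∈ U) (V : E2 → E2) :
    dirD V b z = turn V a b z * a z := by
  have h1 := h.dirD_unit hz V
  have h2 := h.unit z hz
  rw [turn]
  linear_combination (-dirD V b z) * h2 + b z * h1

lemma dirD_frU (h : MinFrame U om a b) {z : E2} (hz : z ∈ U) (V : E2 → E2) :
    dirD V (fun x => frU om a b x 0) z =
      dirD V mu z * Real.sinh (om z) * a z + mu z * (Real.cosh (om z) * dirD V om z) * a z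
        - mu z * Real.sinh (om z) * (turn V a b z * b z) ∧
    dirD V (fun x => frU om a b x 1) z =
      dirD V mu z * Real.sinh (om z) * b z + mu z * (Real.cosh (om z) * dirD V om z) * b z
        + mu z * Real.sinh (om z) * (turn V a b z * a z) := by
  have hm := hasDerivAt_line ((contDiff_mu.differentiable (by simp)) z) (V z)
  have hom := hasDerivAt_line (ContDiffOn.diffAt h.isOpen h.smooth_om hz) (V z)
  have ha := hasDerivAt_line (ContDiffOn.diffAt h.isOpen h.smooth_a hz) (V z)
  have hb := hasDerivAt_line (ContDiffOn.diffAt h.isOpen h.smooth_b hz) (V z)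
  have hV := ContDiffOn.diffAt h.isOpen h.smooth_frU hz
  have ea := h.dirD_a hz V
  have eb := h.dirD_b hz V
  simp only [dirD] at ea eb ⊢
  constructor
  · refine fderiv_eq_of_hasDerivAt_line (by fun_prop) ?_
    simp only [frU_zero]
    refine HasDerivAt.congr_deriv ((hm.mul hom.sinh).mul ha) ?_
    simp [ea]; ring
  · refine fderiv_eq_of_hasDerivAt_line (by fun_prop) ?_
    simp only [frU_one]
    refine HasDerivAt.congr_deriv ((hm.mul hom.sinh).mul hb) ?_
    simp [eb]; ring

lemma dirD_frC (h : MinFrame U om a b) {z : E2} (hz : z ∈ U) (V : E2 → E2) :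
    dirD V (fun x => frC om a b x 0) z =
      -(dirD V mu z * Real.cosh (om z) * b z + mu z * (Real.sinh (om z) * dirD V om z) * b z
        + mu z * Real.cosh (om z) * (turn V a b z * a z)) ∧
    dirD V (fun x => frC om a b x 1) z =
      dirD V mu z * Real.cosh (om z) * a z + mu z * (Real.sinh (om z) * dirD V om z) * a z
        - mu z * Real.cosh (om z) * (turn V a b z * b z) := by
  have hm := hasDerivAt_line ((contDiff_mu.differentiable (by simp)) z) (V z)
  have hom := hasDerivAt_line (ContDiffOn.diffAt h.isOpen h.smooth_om hz) (V z)
  have ha := hasDerivAt_line (ContDiffOn.diffAt h.isOpen h.smooth_a hz) (V z)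
  have hb := hasDerivAt_line (ContDiffOn.diffAt h.isOpen h.smooth_b hz) (V z)
  have hV := ContDiffOn.diffAt h.isOpen h.smooth_frC hz
  have ea := h.dirD_a hz V
  have eb := h.dirD_b hz V
  simp only [dirD] at ea eb ⊢
  constructor
  · refine fderiv_eq_of_hasDerivAt_line (by fun_prop) ?_
    simp only [frC_zero]
    refine HasDerivAt.congr_deriv (((hm.mul hom.cosh).mul hb).neg) ?_
    simp [eb]; ring
  · refine fderiv_eq_of_hasDerivAt_line (by fun_prop) ?_
    simp only [frC_one]
    refine HasDerivAt.congr_deriv ((hm.mul hom.cosh).mul ha) ?_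
    simp [ea]; ring

lemma turn_eq (h : MinFrame U om a b) {z : E2} (hz : z ∈ U) :
    turn (frU om a b) a b z = -dirD (frC om a b) om z
      - (z 0 * b z - z 1 * a z) * Real.sinh (om z) ∧
    turn (frC om a b) a b z = dirD (frU om a b) om z
      - (z 0 * a z + z 1 * b z) * Real.cosh (om z) := by
  have c0 := h.comm z hz 0
  have c1 := h.comm z hz 1
  rw [(h.dirD_frC hz _).1, (h.dirD_frU hz _).1] at c0
  rw [(h.dirD_frC hz _).2, (h.dirD_frU hz _).2] at c1
  have hu := h.unit z hz
  have m1 : dirD (frU om a b) mu z =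
      -(z 0 * (mu z * Real.sinh (om z) * a z) + z 1 * (mu z * Real.sinh (om z) * b z)) := by
    simp [dirD, fderiv_mu]
  have m2 : dirD (frC om a b) mu z =
      -(z 0 * -(mu z * Real.cosh (om z) * b z) + z 1 * (mu z * Real.cosh (om z) * a z)) := by
    simp [dirD, fderiv_mu]
  rw [m1, m2] at c0 c1
  have hm := (mu_pos (h.sub z hz)).ne'
  have hs : Real.sinh (om z) ≠ 0 := (Real.sinh_pos_iff.2 (h.pos z hz)).ne'
  have hc : Real.cosh (om z) ≠ 0 := (Real.cosh_pos _).ne'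
  set T1 := turn (frU om a b) a b z
  set T2 := turn (frC om a b) a b z
  constructor
  · apply mul_left_cancel₀ hm
    apply mul_left_cancel₀ hc
    linear_combination (-a z) * c0 - b z * c1 + (mu z * Real.cosh (om z)) *
      (-T1 - dirD (frC om a b) om z - (z 0 * b z - z 1 * a z) * Real.sinh (om z)) * hu
  · apply mul_left_cancel₀ hm
    apply mul_left_cancel₀ hs
    linear_combination (b z) * c0 - a z * c1 + (mu z * Real.sinh (om z)) *
      (-T2 + dirD (frU om a b) om z - (z 0 * a z + z 1 * b z) * Real.cosh (om z)) * hu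

/-- The sum of the second derivatives along the two commuting fields. -/
def lap (om a b : E2 → ℝ) (f : E2 → ℝ) (z : E2) : ℝ :=
  dirD (frU om a b) (dirD (frU om a b) f) z + dirD (frC om a b) (dirD (frC om a b) f) z

lemma comm_apply (h : MinFrame U om a b) {f : E2 → ℝ} (hf : ContDiffOn ℝ ∞ f U) {z : E2}
    (hz : z ∈ U) : dirD (frU om a b) (dirD (frC om a b) f) z =
      dirD (frC om a b) (dirD (frU om a b) f) z :=
  dirD_comm h.isOpen h.smooth_frU h.smooth_frC hf hz (h.comm z hz)

/-- The sinh-Gordon equation. -/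
lemma lap_om (h : MinFrame U om a b) {z : E2} (hz : z ∈ U) :
    lap om a b om z = Real.sinh (om z) * Real.cosh (om z) := by
  set V := frU om a b with hVd
  set W := frC om a b with hWd
  have hVs := h.smooth_frU
  have hWs := h.smooth_frC
  have hom := hasDerivAt_line (ContDiffOn.diffAt h.isOpen h.smooth_om hz)
  have ha := hasDerivAt_line (ContDiffOn.diffAt h.isOpen h.smooth_a hz)
  have hb := hasDerivAt_line (ContDiffOn.diffAt h.isOpen h.smooth_b hz)
  have dif : ∀ {X : E2 → E2} {f : E2 → ℝ}, ContDiffOn ℝ ∞ X U → ContDiffOn ℝ ∞ f U →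
      DifferentiableAt ℝ (dirD X f) z := fun hX hf =>
    ContDiffOn.diffAt h.isOpen (ContDiffOn.dirD h.isOpen hX hf) hz
  have turn_diff : ∀ {X : E2 → E2}, ContDiffOn ℝ ∞ X U → ∀ v : E2,
      HasDerivAt (fun t : ℝ => turn X a b (z + t • v))
        (fderiv ℝ a z v * dirD X b z + a z * fderiv ℝ (dirD X b) z v
          - (fderiv ℝ b z v * dirD X a z + b z * fderiv ℝ (dirD X a) z v)) 0 := by
    intro X hX v
    have h1 := hasDerivAt_line (dif hX h.smooth_a) v
    have h2 := hasDerivAt_line (dif hX h.smooth_b) v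
    refine HasDerivAt.congr_deriv (((ha v).mul h2).sub ((hb v).mul h1)) ?_
    simp
  have hsmT : ∀ {X : E2 → E2}, ContDiffOn ℝ ∞ X U → ContDiffOn ℝ ∞ (turn X a b) U := fun hX =>
    (h.smooth_a.mul (ContDiffOn.dirD h.isOpen hX h.smooth_b)).sub
      (h.smooth_b.mul (ContDiffOn.dirD h.isOpen hX h.smooth_a))
  have key : dirD V (turn W a b) z = dirD W (turn V a b) z := by
    have e1 := fderiv_eq_of_hasDerivAt_line (ContDiffOn.diffAt h.isOpen (hsmT hWs) hz)
      (turn_diff hWs (V z))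
    have e2 := fderiv_eq_of_hasDerivAt_line (ContDiffOn.diffAt h.isOpen (hsmT hVs) hz)
      (turn_diff hVs (W z))
    have ca := h.comm_apply h.smooth_a hz
    have cb := h.comm_apply h.smooth_b hz
    have a1 := h.dirD_a hz V
    have a2 := h.dirD_a hz W
    have b1 := h.dirD_b hz V
    have b2 := h.dirD_b hz W
    rw [← hVd, ← hWd] at ca cb
    change dirD V (turn W a b) z = dirD V a z * dirD W b z + a z * dirD V (dirD W b) z -
      (dirD V b z * dirD W a z + b z * dirD V (dirD W a) z) at e1
    change dirD W (turn V a b) z = dirD W a z * dirD V b z + a z * dirD W (dirD V b) z -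
      (dirD W b z * dirD V a z + b z * dirD W (dirD V a) z) at e2
    rw [e1, e2, ca, cb, a1, a2, b1, b2]; ring
  have t1 := (h.turn_eq hz).1
  have t2 := (h.turn_eq hz).2
  rw [← hVd, ← hWd] at t1 t2
  have hx := fun v => hasDerivAt_coord z v 0
  have hy := fun v => hasDerivAt_coord z v 1
  have k1 : dirD V (turn W a b) z = dirD V (dirD V om) z -
      ((V z 0 * a z + z 0 * dirD V a z + (V z 1 * b z + z 1 * dirD V b z)) * Real.cosh (om z) +
        (z 0 * a z + z 1 * b z) * (Real.sinh (om z) * dirD V om z)) := by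
    rw [dirD_congr h.isOpen hz (fun x hx => (h.turn_eq hx).2)]
    have d1 := dif hVs h.smooth_om
    have dom := ContDiffOn.diffAt h.isOpen h.smooth_om hz
    have da := ContDiffOn.diffAt h.isOpen h.smooth_a hz
    have db := ContDiffOn.diffAt h.isOpen h.smooth_b hz
    refine fderiv_eq_of_hasDerivAt_line (by fun_prop) ?_
    refine HasDerivAt.congr_deriv ((hasDerivAt_line d1 (V z)).sub ((((hx (V z)).mul (ha (V z))).add
      ((hy (V z)).mul (hb (V z)))).mul (hom (V z)).cosh)) ?_
    simp [dirD, hVd]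
  have k2 : dirD W (turn V a b) z = -dirD W (dirD W om) z -
      ((W z 0 * b z + z 0 * dirD W b z - (W z 1 * a z + z 1 * dirD W a z)) * Real.sinh (om z) +
        (z 0 * b z - z 1 * a z) * (Real.cosh (om z) * dirD W om z)) := by
    rw [dirD_congr h.isOpen hz (fun x hx => (h.turn_eq hx).1)]
    have d1 := dif hWs h.smooth_om
    have dom := ContDiffOn.diffAt h.isOpen h.smooth_om hz
    have da := ContDiffOn.diffAt h.isOpen h.smooth_a hz
    have db := ContDiffOn.diffAt h.isOpen h.smooth_b hz
    refine fderiv_eq_of_hasDerivAt_line (by fun_prop) ?_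
    refine HasDerivAt.congr_deriv ((hasDerivAt_line d1 (W z)).neg.sub
      ((((hx (W z)).mul (hb (W z))).sub ((hy (W z)).mul (ha (W z)))).mul (hom (W z)).sinh)) ?_
    simp [dirD, hWd]
  have hu := h.unit z hz
  have hmu : mu z = (1 - (z 0 ^ 2 + z 1 ^ 2)) / 2 := rfl
  rw [h.dirD_a hz, h.dirD_b hz, t2] at k2
  rw [h.dirD_a hz, h.dirD_b hz, t1] at k1
  simp only [hVd, hWd, frU_zero, frU_one, frC_zero, frC_one] at k1 k2
  simp only [← hVd, ← hWd] at k1 k2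
  rw [k1, k2] at key
  change dirD V (dirD V om) z + dirD W (dirD W om) z = _
  rw [hmu] at key
  linear_combination key + (Real.sinh (om z) * Real.cosh (om z)) * hu

/-- The coordinate functions satisfy the harmonic map equation. -/
lemma lap_coord (h : MinFrame U om a b) {z : E2} (hz : z ∈ U) :
    lap om a b (fun x => x 0) z =
      mu z * ((z 0 * a z + z 1 * b z) * a z - (z 0 * b z - z 1 * a z) * b z) ∧
    lap om a b (fun x => x 1) z =
      mu z * ((z 0 * a z + z 1 * b z) * b z + (z 0 * b z - z 1 * a z) * a z) := by
  have e : ∀ (V : E2 → E2) (i : Fin 2), dirD V (fun x : E2 => x i) = fun x => V x i := by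
    intro V i; ext x; exact fderiv_coord x (V x) i
  have t1 := (h.turn_eq hz).1
  have t2 := (h.turn_eq hz).2
  have m1 : dirD (frU om a b) mu z =
      -(z 0 * (mu z * Real.sinh (om z) * a z) + z 1 * (mu z * Real.sinh (om z) * b z)) := by
    simp [dirD, fderiv_mu]
  have m2 : dirD (frC om a b) mu z =
      -(z 0 * -(mu z * Real.cosh (om z) * b z) + z 1 * (mu z * Real.cosh (om z) * a z)) := by
    simp [dirD, fderiv_mu]
  have hcs := Real.cosh_sq (om z)
  simp only [lap, e]
  rw [(h.dirD_frC hz _).1, (h.dirD_frU hz _).1, (h.dirD_frC hz _).2, (h.dirD_frU hz _).2,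
    t1, t2, m1, m2]
  constructor
  · linear_combination (mu z * ((z 0 * a z + z 1 * b z) * a z - (z 0 * b z - z 1 * a z) * b z)) *
      hcs
  · linear_combination (mu z * ((z 0 * a z + z 1 * b z) * b z + (z 0 * b z - z 1 * a z) * a z)) *
      hcs

end MinFrame

/-! ### A gradient estimate by the maximum principle -/

lemma dirD_congr_deriv {V : E2 → E2} {f : E2 → ℝ} {z : E2} {d : ℝ}
    (hf : DifferentiableAt ℝ f z) (h : HasDerivAt (fun t : ℝ => f (z + t • V z)) d 0) :
    dirD V f z = d := fderiv_eq_of_hasDerivAt_line hf h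

lemma diffAt_div {f g : E2 → ℝ} {z : E2} (hf : DifferentiableAt ℝ f z)
    (hg : DifferentiableAt ℝ g z) (h0 : g z ≠ 0) : DifferentiableAt ℝ (fun x => f x / g x) z := by
  simp only [div_eq_mul_inv]
  exact hf.mul (hg.inv h0)

namespace MinFrame

variable {U : Set E2} {om a b : E2 → ℝ}

/-- The squared norm of the gradient of `om` in the frame. -/
def grd (om a b : E2 → ℝ) (z : E2) : ℝ :=
  dirD (frU om a b) om z ^ 2 + dirD (frC om a b) om z ^ 2

/-- The logarithm of the quantity to which the maximum principle is applied. -/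
def logQ (h : E2 → ℝ) (om a b : E2 → ℝ) (z : E2) : ℝ :=
  2 * Real.log (h z) - 6 * om z - 2 * Real.log (Real.sinh (om z)) + Real.log (grd om a b z)

lemma smooth_w (h : MinFrame U om a b) : ContDiffOn ℝ ∞ (dirD (frU om a b) om) U ∧
    ContDiffOn ℝ ∞ (dirD (frC om a b) om) U :=
  ⟨ContDiffOn.dirD h.isOpen h.smooth_frU h.smooth_om,
    ContDiffOn.dirD h.isOpen h.smooth_frC h.smooth_om⟩

lemma smooth_grd (h : MinFrame U om a b) : ContDiffOn ℝ ∞ (grd om a b) U :=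
  (h.smooth_w.1.pow 2).add (h.smooth_w.2.pow 2)

lemma dirD_grd (h : MinFrame U om a b) {z : E2} (hz : z ∈ U) (X : E2 → E2) :
    dirD X (grd om a b) z =
      2 * (dirD (frU om a b) om z * dirD X (dirD (frU om a b) om) z +
        dirD (frC om a b) om z * dirD X (dirD (frC om a b) om) z) := by
  have h1 := hasDerivAt_line (ContDiffOn.diffAt h.isOpen h.smooth_w.1 hz) (X z)
  have h2 := hasDerivAt_line (ContDiffOn.diffAt h.isOpen h.smooth_w.2 hz) (X z)
  refine dirD_congr_deriv (ContDiffOn.diffAt h.isOpen h.smooth_grd hz) ?_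
  refine HasDerivAt.congr_deriv ((h1.pow 2).add (h2.pow 2)) ?_
  simp [dirD]; ring

lemma dirD_dirD_grd (h : MinFrame U om a b) {z : E2} (hz : z ∈ U) {X : E2 → E2}
    (hX : ContDiffOn ℝ ∞ X U) :
    dirD X (dirD X (grd om a b)) z =
      2 * (dirD X (dirD (frU om a b) om) z ^ 2 +
        dirD (frU om a b) om z * dirD X (dirD X (dirD (frU om a b) om)) z +
        (dirD X (dirD (frC om a b) om) z ^ 2 +
        dirD (frC om a b) om z * dirD X (dirD X (dirD (frC om a b) om)) z)) := by
  have g1 := ContDiffOn.dirD h.isOpen hX h.smooth_w.1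
  have g2 := ContDiffOn.dirD h.isOpen hX h.smooth_w.2
  have h1 := hasDerivAt_line (ContDiffOn.diffAt h.isOpen h.smooth_w.1 hz) (X z)
  have h2 := hasDerivAt_line (ContDiffOn.diffAt h.isOpen h.smooth_w.2 hz) (X z)
  have h3 := hasDerivAt_line (ContDiffOn.diffAt h.isOpen g1 hz) (X z)
  have h4 := hasDerivAt_line (ContDiffOn.diffAt h.isOpen g2 hz) (X z)
  rw [dirD_congr h.isOpen hz (fun x hx => h.dirD_grd hx X)]
  refine dirD_congr_deriv (ContDiffOn.diffAt h.isOpen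
    (contDiffOn_const.mul ((h.smooth_w.1.mul g1).add (h.smooth_w.2.mul g2))) hz) ?_
  refine HasDerivAt.congr_deriv (((h1.mul h3).add (h2.mul h4)).const_mul 2) ?_
  simp [dirD]; ring

/-- The derivative of the sinh-Gordon equation. -/
lemma lap_w (h : MinFrame U om a b) {z : E2} (hz : z ∈ U) :
    lap om a b (dirD (frU om a b) om) z =
      (Real.cosh (om z) ^ 2 + Real.sinh (om z) ^ 2) * dirD (frU om a b) om z ∧
    lap om a b (dirD (frC om a b) om) z =
      (Real.cosh (om z) ^ 2 + Real.sinh (om z) ^ 2) * dirD (frC om a b) om z := by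
  have hV := h.smooth_frU
  have hW := h.smooth_frC
  have h1 := h.smooth_w.1
  have h2 := h.smooth_w.2
  have h11 := ContDiffOn.dirD h.isOpen hV h1
  have h22 := ContDiffOn.dirD h.isOpen hW h2
  have hom := ContDiffOn.diffAt h.isOpen h.smooth_om hz
  have key : ∀ X : E2 → E2, dirD X (dirD (frU om a b) (dirD (frU om a b) om)) z +
      dirD X (dirD (frC om a b) (dirD (frC om a b) om)) z =
      (Real.cosh (om z) ^ 2 + Real.sinh (om z) ^ 2) * dirD X om z := by
    intro X
    have d1 := hasDerivAt_line (ContDiffOn.diffAt h.isOpen h11 hz) (X z)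
    have d2 := hasDerivAt_line (ContDiffOn.diffAt h.isOpen h22 hz) (X z)
    have e1 : dirD X (lap om a b om) z = dirD X (dirD (frU om a b) (dirD (frU om a b) om)) z +
      dirD X (dirD (frC om a b) (dirD (frC om a b) om)) z :=
      dirD_congr_deriv (ContDiffOn.diffAt h.isOpen (h11.add h22) hz) (d1.add d2)
    rw [← e1, dirD_congr h.isOpen hz (fun x hx => h.lap_om hx)]
    have d3 := hasDerivAt_line hom (X z)
    refine dirD_congr_deriv (by fun_prop) ?_
    refine HasDerivAt.congr_deriv (d3.sinh.mul d3.cosh) ?_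
    simp [dirD]; ring
  constructor
  · rw [← key, lap]
    congr 1
    rw [dirD_congr h.isOpen hz (fun x hx => (h.comm_apply h.smooth_om hx).symm),
      ← h.comm_apply h2 hz]
  · rw [← key, lap]
    congr 1
    rw [dirD_congr h.isOpen hz (fun x hx => h.comm_apply h.smooth_om hx),
      h.comm_apply h1 hz]

lemma dirD_logQ (hF : MinFrame U om a b) {h : E2 → ℝ} (hh : ContDiffOn ℝ ∞ h U)
    {z : E2} (hz : z ∈ U) (hpos : 0 < h z) (hS : 0 < grd om a b z) (X : E2 → E2) :
    dirD X (logQ h om a b) z = 2 * (dirD X h z / h z) -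
      (6 + 2 * (Real.cosh (om z) / Real.sinh (om z))) * dirD X om z +
      dirD X (grd om a b) z / grd om a b z := by
  have d1 := ContDiffOn.diffAt hF.isOpen hh hz
  have d2 := ContDiffOn.diffAt hF.isOpen hF.smooth_om hz
  have d3 := ContDiffOn.diffAt hF.isOpen hF.smooth_grd hz
  have hs := (Real.sinh_pos_iff.2 (hF.pos z hz)).ne'
  have l1 := hasDerivAt_line d1 (X z)
  have l2 := hasDerivAt_line d2 (X z)
  have l3 := hasDerivAt_line d3 (X z)
  have l1' := l1.log (by simpa using hpos.ne')
  have l2' := l2.sinh.log (by simpa using hs)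
  have l3' := l3.log (by simpa using hS.ne')
  refine dirD_congr_deriv ?_ ?_
  · unfold logQ
    exact ((((d1.log hpos.ne').const_mul 2).sub (d2.const_mul 6)).sub
      ((d2.sinh.log hs).const_mul 2)).add (d3.log hS.ne')
  · refine HasDerivAt.congr_deriv ((((l1'.const_mul 2).sub (l2.const_mul 6)).sub
      (l2'.const_mul 2)).add l3') ?_
    simp [dirD]; ring

lemma smooth_logQ (hF : MinFrame U om a b) {h : E2 → ℝ} (hh : ContDiffOn ℝ ∞ h U)
    (hpos : ∀ z ∈ U, 0 < h z) (hS : ∀ z ∈ U, 0 < grd om a b z) :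
    ContDiffOn ℝ ∞ (logQ h om a b) U :=
  (((contDiffOn_const.mul (hh.log fun z hz => (hpos z hz).ne')).sub
    (contDiffOn_const.mul hF.smooth_om)).sub
    (contDiffOn_const.mul ((hF.smooth_om.sinh).log
      fun z hz => (Real.sinh_pos_iff.2 (hF.pos z hz)).ne'))).add
    (hF.smooth_grd.log fun z hz => (hS z hz).ne')

lemma dirD_dirD_logQ (hF : MinFrame U om a b) {h : E2 → ℝ} (hh : ContDiffOn ℝ ∞ h U)
    (hpos : ∀ z ∈ U, 0 < h z) (hS : ∀ z ∈ U, 0 < grd om a b z) {X : E2 → E2}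
    (hX : ContDiffOn ℝ ∞ X U) {z : E2} (hz : z ∈ U) :
    dirD X (dirD X (logQ h om a b)) z =
      2 * ((dirD X (dirD X h) z * h z - dirD X h z ^ 2) / h z ^ 2) +
      2 * (1 / Real.sinh (om z) ^ 2) * dirD X om z ^ 2 -
      (6 + 2 * (Real.cosh (om z) / Real.sinh (om z))) * dirD X (dirD X om) z +
      (dirD X (dirD X (grd om a b)) z * grd om a b z - dirD X (grd om a b) z ^ 2) /
        grd om a b z ^ 2 := by
  rw [dirD_congr hF.isOpen hz (fun x hx => hF.dirD_logQ hh hx (hpos x hx) (hS x hx) X)]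
  have d1 := ContDiffOn.diffAt hF.isOpen hh hz
  have d2 := ContDiffOn.diffAt hF.isOpen hF.smooth_om hz
  have d3 := ContDiffOn.diffAt hF.isOpen hF.smooth_grd hz
  have e1 := ContDiffOn.diffAt hF.isOpen (ContDiffOn.dirD hF.isOpen hX hh) hz
  have e2 := ContDiffOn.diffAt hF.isOpen (ContDiffOn.dirD hF.isOpen hX hF.smooth_om) hz
  have e3 := ContDiffOn.diffAt hF.isOpen (ContDiffOn.dirD hF.isOpen hX hF.smooth_grd) hz
  have hs := (Real.sinh_pos_iff.2 (hF.pos z hz)).ne'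
  have h0 := (hpos z hz).ne'
  have hS0 := (hS z hz).ne'
  have l1 := hasDerivAt_line d1 (X z)
  have l2 := hasDerivAt_line d2 (X z)
  have l3 := hasDerivAt_line d3 (X z)
  have m1 := hasDerivAt_line e1 (X z)
  have m2 := hasDerivAt_line e2 (X z)
  have m3 := hasDerivAt_line e3 (X z)
  have hcs := Real.cosh_sq (om z)
  refine dirD_congr_deriv ?_ ?_
  · have q : DifferentiableAt ℝ (fun x => Real.cosh (om x) / Real.sinh (om x)) z :=
      diffAt_div d2.cosh d2.sinh hs
    exact (((diffAt_div e1 d1 h0).const_mul 2).sub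
      (((q.const_mul 2).const_add 6).mul e2)).add (diffAt_div e3 d3 hS0)
  · refine HasDerivAt.congr_deriv ((((m1.div l1 (by simpa using h0)).const_mul 2).sub
      ((((l2.cosh.div l2.sinh (by simpa using hs)).const_mul 2).const_add 6).mul m2)).add
      (m3.div l3 (by simpa using hS0))) ?_
    simp only [zero_smul, add_zero, Pi.div_apply]
    change 2 * ((dirD X (dirD X h) z * h z - dirD X h z * dirD X h z) / h z ^ 2) -
      (2 * ((Real.sinh (om z) * dirD X om z * Real.sinh (om z) -
        Real.cosh (om z) * (Real.cosh (om z) * dirD X om z)) / Real.sinh (om z) ^ 2) *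
        dirD X om z + (6 + 2 * (Real.cosh (om z) / Real.sinh (om z))) * dirD X (dirD X om) z) +
      (dirD X (dirD X (grd om a b)) z * grd om a b z -
        dirD X (grd om a b) z * dirD X (grd om a b) z) / grd om a b z ^ 2 = _
    have : Real.sinh (om z) * dirD X om z * Real.sinh (om z) -
        Real.cosh (om z) * (Real.cosh (om z) * dirD X om z) = -dirD X om z := by
      linear_combination (-dirD X om z) * hcs
    rw [this]
    ring

end MinFrame

lemma quadratic_lower_bound {f m G S Q k : ℝ} (h : m ^ 2 ≤ G * S) :
    (-(2 * G) - 2 * f * Q + 2 * k) * S ≤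
      2 * f ^ 2 - 2 * f * Q * S + 4 * f * m + 2 * k * S := by
  linarith [sq_nonneg (f + m)]

lemma gradient_max_ineq {s c h v1 v2 A B D h1 h2 L S : ℝ} (hs : 0 < s) (hc : 0 < c)
    (hcs : c ^ 2 = s ^ 2 + 1) (hh : 0 < h) (hh1 : h ≤ 1) (hS : 0 < S)
    (hSd : S = v1 ^ 2 + v2 ^ 2) (tr : A + D = s * c)
    (e1 : 2 * (h1 / h) - (6 + 2 * (c / s)) * v1 + 2 * (v1 * A + v2 * B) / S = 0)
    (e2 : 2 * (h2 / h) - (6 + 2 * (c / s)) * v2 + 2 * (v1 * B + v2 * D) / S = 0)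
    (ineq : 2 * (L / h) - 2 * ((h1 / h) ^ 2 + (h2 / h) ^ 2) + 2 * (1 / s ^ 2) * S
      - (6 + 2 * (c / s)) * (s * c)
      + (((2 * (A ^ 2 + 2 * B ^ 2 + D ^ 2) + 2 * ((c ^ 2 + s ^ 2) * S)) * S
        - ((2 * (v1 * A + v2 * B)) ^ 2 + (2 * (v1 * B + v2 * D)) ^ 2)) / S ^ 2) ≤ 0)
    (hL : -L ≤ 2 * c ^ 2) (hg : h1 ^ 2 + h2 ^ 2 ≤ c ^ 2) :
    h ^ 2 * S ≤ 15 * (s ^ 2 * c ^ 2) := by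
  have hsc : s ≤ c := (sq_le_sq₀ hs.le hc.le).1 (by linarith)
  have hh2 : h ^ 2 ≤ 1 := pow_le_one₀ hh.le hh1
  have sc : s * c ≤ c ^ 2 := by rw [pow_two]; gcongr
  have hc2 : c ^ 2 ≤ c ^ 2 / h ^ 2 := by
    rw [le_div_iff₀ (by positivity)]
    exact mul_le_of_le_one_right (sq_nonneg c) hh2
  have g : (h1 / h) ^ 2 + (h2 / h) ^ 2 ≤ c ^ 2 / h ^ 2 := by
    rw [div_pow, div_pow, ← add_div]; gcongr
  have l : -(L / h) ≤ 2 * c ^ 2 / h ^ 2 := by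
    rw [← neg_div, div_le_div_iff₀ hh (by positivity)]
    nlinarith [mul_le_mul_of_nonneg_right hL (sq_nonneg h), sq_nonneg c,
      mul_nonneg (mul_nonneg (sq_nonneg c) hh.le) (sub_nonneg.2 hh1)]
  set n1 := h1 / h
  set n2 := h2 / h
  set Q := 6 + 2 * (c / s) with hQ
  have hQf : Q * (s * c) = 6 * (s * c) + 2 * c ^ 2 := by rw [hQ]; field_simp
  have k1 : v1 * A + v2 * B = S * (Q * v1 / 2 - n1) := by
    field_simp at e1; linarith
  have k2 : v1 * B + v2 * D = S * (Q * v2 / 2 - n2) := by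
    field_simp at e2; linarith
  have id1 : (A ^ 2 + 2 * B ^ 2 + D ^ 2) * S -
      2 * ((v1 * A + v2 * B) ^ 2 + (v1 * B + v2 * D) ^ 2) =
      (A + D) ^ 2 * S - 2 * (A + D) * ((v1 * A + v2 * B) * v1 + (v1 * B + v2 * D) * v2) := by
    rw [hSd]; ring
  rw [tr] at id1
  have id2 : ((2 * (A ^ 2 + 2 * B ^ 2 + D ^ 2) + 2 * ((c ^ 2 + s ^ 2) * S)) * S
        - ((2 * (v1 * A + v2 * B)) ^ 2 + (2 * (v1 * B + v2 * D)) ^ 2)) =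
      S * (2 * (s * c) ^ 2 - 2 * (s * c) * Q * S + 4 * (s * c) * (n1 * v1 + n2 * v2)
        + 2 * (c ^ 2 + s ^ 2) * S) := by
    have : (v1 * A + v2 * B) * v1 + (v1 * B + v2 * D) * v2 =
        S * (Q * S / 2 - (n1 * v1 + n2 * v2)) := by
      rw [k1, k2, hSd]; ring
    rw [this] at id1
    linear_combination 2 * id1
  rw [id2, pow_two S, mul_div_mul_left _ _ hS.ne'] at ineq
  have cs : (n1 * v1 + n2 * v2) ^ 2 ≤ (n1 ^ 2 + n2 ^ 2) * S := by
    rw [hSd]; linear_combination sq_nonneg (n1 * v2 - n2 * v1)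
  have low : -(2 * (n1 ^ 2 + n2 ^ 2)) - 2 * (s * c) * Q + 2 * (c ^ 2 + s ^ 2) ≤
      (2 * (s * c) ^ 2 - 2 * (s * c) * Q * S + 4 * (s * c) * (n1 * v1 + n2 * v2)
        + 2 * (c ^ 2 + s ^ 2) * S) / S := by
    rw [le_div_iff₀ hS]
    exact quadratic_lower_bound cs
  have fin : 2 * (1 / s ^ 2) * S ≤ 30 * (c ^ 2 / h ^ 2) := by
    have l' : -(L / h) ≤ 2 * (c ^ 2 / h ^ 2) := by linarith [l, mul_div_assoc 2 (c ^ 2) (h ^ 2)]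
    have hQf' : 2 * (s * c) * Q = 2 * (6 * (s * c) + 2 * c ^ 2) := by rw [← hQf]; ring
    rw [hQf] at ineq
    linarith [sq_nonneg s]
  have e : 2 * (1 / s ^ 2) * S * (s ^ 2 * h ^ 2) = 2 * (h ^ 2 * S) := by field_simp
  have e' : 30 * (c ^ 2 / h ^ 2) * (s ^ 2 * h ^ 2) = 30 * (s ^ 2 * c ^ 2) := by field_simp
  have := mul_le_mul_of_nonneg_right fin (by positivity : 0 ≤ s ^ 2 * h ^ 2)
  linarith

/-- The barrier function of the disk of center `p` and radius `R`. -/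
def barrier (p : E2) (R : ℝ) (z : E2) : ℝ := R ^ 2 - ((z 0 - p 0) ^ 2 + (z 1 - p 1) ^ 2)

lemma contDiff_barrier (p : E2) (R : ℝ) : ContDiff ℝ ∞ (barrier p R) := by
  unfold barrier; fun_prop

lemma dirD_barrier (p : E2) (R : ℝ) (X : E2 → E2) (z : E2) :
    dirD X (barrier p R) z = -2 * ((z 0 - p 0) * X z 0 + (z 1 - p 1) * X z 1) := by
  have h0 := hasDerivAt_coord z (X z) 0
  have h1 := hasDerivAt_coord z (X z) 1
  refine dirD_congr_deriv ((contDiff_barrier p R).differentiable (by simp) z) ?_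
  refine HasDerivAt.congr_deriv
    ((((h0.sub_const (p 0)).pow 2).add ((h1.sub_const (p 1)).pow 2)).const_sub (R ^ 2)) ?_
  simp; ring

namespace MinFrame

variable {U : Set E2} {om a b : E2 → ℝ}

lemma lap_barrier (h : MinFrame U om a b) (p : E2) (R : ℝ) {z : E2} (hz : z ∈ U) :
    lap om a b (barrier p R) z = -2 * (mu z ^ 2 * (Real.sinh (om z) ^ 2 + Real.cosh (om z) ^ 2)
      + (z 0 - p 0) * lap om a b (fun x => x 0) z + (z 1 - p 1) * lap om a b (fun x => x 1) z) := by
  have e : ∀ (V : E2 → E2) (i : Fin 2), dirD V (fun x : E2 => x i) = fun x => V x i := by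
    intro V i; ext x; exact fderiv_coord x (V x) i
  have key : ∀ {X : E2 → E2}, ContDiffOn ℝ ∞ X U → dirD X (dirD X (barrier p R)) z =
      -2 * (X z 0 ^ 2 + (z 0 - p 0) * dirD X (fun x => X x 0) z +
        (X z 1 ^ 2 + (z 1 - p 1) * dirD X (fun x => X x 1) z)) := by
    intro X hX
    have hX' := ContDiffOn.diffAt h.isOpen hX hz
    have h0 := hasDerivAt_coord z (X z) 0
    have h1 := hasDerivAt_coord z (X z) 1
    have k0 := hasDerivAt_line (f := fun x => X x 0) (z := z) (by fun_prop) (X z)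
    have k1 := hasDerivAt_line (f := fun x => X x 1) (z := z) (by fun_prop) (X z)
    have : dirD X (barrier p R) =
        fun z => -2 * ((z 0 - p 0) * X z 0 + (z 1 - p 1) * X z 1) := by
      ext z; exact dirD_barrier p R X z
    rw [this]
    refine dirD_congr_deriv (by fun_prop) ?_
    refine HasDerivAt.congr_deriv ((((h0.sub_const (p 0)).mul k0).add
      ((h1.sub_const (p 1)).mul k1)).const_mul (-2)) ?_
    simp [dirD]; ring
  have hu := h.unit z hz
  rw [lap, key h.smooth_frU, key h.smooth_frC]
  simp only [lap, e, frU_zero, frU_one, frC_zero, frC_one]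
  linear_combination (-2 * mu z ^ 2 * (Real.sinh (om z) ^ 2 + Real.cosh (om z) ^ 2)) * hu

lemma neg_lap_barrier_le {m s c x y d e a b : ℝ} (hm0 : 0 < m) (hm1 : m ≤ 1 / 2)
    (hcs : c ^ 2 = s ^ 2 + 1) (hu : a ^ 2 + b ^ 2 = 1) (hd : d ^ 2 + e ^ 2 ≤ 1)
    (hz : x ^ 2 + y ^ 2 ≤ 1) :
    -(-2 * (m ^ 2 * (s ^ 2 + c ^ 2) + d * (m * ((x * a + y * b) * a - (x * b - y * a) * b))
      + e * (m * ((x * a + y * b) * b + (x * b - y * a) * a)))) ≤ 2 * c ^ 2 := by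
  set k := (x * a + y * b) * a - (x * b - y * a) * b
  set l := (x * a + y * b) * b + (x * b - y * a) * a
  have hk : k ^ 2 + l ^ 2 ≤ 1 := by
    have : k ^ 2 + l ^ 2 = (x ^ 2 + y ^ 2) * (a ^ 2 + b ^ 2) ^ 2 := by ring
    rw [this, hu]; linarith
  have h1 : d * k + e * l ≤ 1 := by nlinarith [sq_nonneg (d - k), sq_nonneg (e - l)]
  have h2 : m * (d * k + e * l) ≤ 1 / 2 := by nlinarith
  have h3 : m ^ 2 ≤ 1 / 4 := by nlinarith
  have h4 : m ^ 2 * (s ^ 2 + c ^ 2) ≤ 1 / 4 * (s ^ 2 + c ^ 2) := by gcongr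
  linarith [sq_nonneg s]

lemma grad_barrier_le {m s c d e a b : ℝ} (hm0 : 0 < m) (hm1 : m ≤ 1 / 2)
    (hcs : c ^ 2 = s ^ 2 + 1) (hu : a ^ 2 + b ^ 2 = 1) (hd : d ^ 2 + e ^ 2 ≤ 1) :
    (-2 * (d * (m * s * a) + e * (m * s * b))) ^ 2 +
      (-2 * (d * -(m * c * b) + e * (m * c * a))) ^ 2 ≤ c ^ 2 := by
  have h3 : m ^ 2 ≤ 1 / 4 := by nlinarith
  have h4 : (d * a + e * b) ^ 2 + (e * a - d * b) ^ 2 ≤ 1 := by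
    have : (d * a + e * b) ^ 2 + (e * a - d * b) ^ 2 = (d ^ 2 + e ^ 2) * (a ^ 2 + b ^ 2) := by ring
    rw [this, hu]; linarith
  have h5 : m ^ 2 * (c ^ 2 * ((d * a + e * b) ^ 2 + (e * a - d * b) ^ 2)) ≤
      1 / 4 * (c ^ 2 * 1) := by gcongr
  have h6 : 0 ≤ m ^ 2 * (d * a + e * b) ^ 2 := by positivity
  linear_combination 4 * h5 + (-4 * m ^ 2 * (d * a + e * b) ^ 2) * hcs + 4 * h6

/-- The estimate at an interior maximum. -/
lemma grd_le_of_isLocalMax (hF : MinFrame U om a b) {p : E2} {R : ℝ} (hR0 : 0 ≤ R) (hR : R ≤ 1)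
    (hpos : ∀ z ∈ U, 0 < barrier p R z) (hS : ∀ z ∈ U, 0 < grd om a b z) {z : E2} (hz : z ∈ U)
    (hmax : IsLocalMax (logQ (barrier p R) om a b) z) :
    barrier p R z ^ 2 * grd om a b z ≤ 15 * (Real.sinh (om z) ^ 2 * Real.cosh (om z) ^ 2) := by
  have hb := (contDiff_barrier p R).contDiffOn (s := U)
  have hs := Real.sinh_pos_iff.2 (hF.pos z hz)
  have hc := Real.cosh_pos (om z)
  have hcs := Real.cosh_sq (om z)
  have hm0 := mu_pos (hF.sub z hz)
  have hm1 := mu_le z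
  have hu := hF.unit z hz
  have e1 := hmax.dirD_eq_zero (V := frU om a b)
  have e2 := hmax.dirD_eq_zero (V := frC om a b)
  have i1 := hmax.dirD_dirD_nonpos hF.isOpen hF.smooth_frU (hF.smooth_logQ hb hpos hS) hz
  have i2 := hmax.dirD_dirD_nonpos hF.isOpen hF.smooth_frC (hF.smooth_logQ hb hpos hS) hz
  rw [hF.dirD_logQ hb hz (hpos z hz) (hS z hz), hF.dirD_grd hz] at e1 e2
  rw [hF.dirD_dirD_logQ hb hpos hS (by first | exact hF.smooth_frU | exact hF.smooth_frC) hz,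
    hF.dirD_dirD_grd hz (by first | exact hF.smooth_frU | exact hF.smooth_frC),
    hF.dirD_grd hz] at i1 i2
  have comm := hF.comm_apply hF.smooth_om hz
  have lw := hF.lap_w hz
  have lo := hF.lap_om hz
  have lb := hF.lap_barrier p R hz
  have lc := hF.lap_coord hz
  have hbz := hpos z hz
  have hR2 : R ^ 2 ≤ 1 := by nlinarith
  have hd : (z 0 - p 0) ^ 2 + (z 1 - p 1) ^ 2 ≤ 1 := by
    rw [barrier] at hbz; linarith
  rw [comm] at e1 i1
  refine gradient_max_ineq (h1 := dirD (frU om a b) (barrier p R) z)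
    (h2 := dirD (frC om a b) (barrier p R) z) (L := lap om a b (barrier p R) z)
    hs hc hcs hbz ?_ (hS z hz) rfl lo e1 e2 ?_ ?_ ?_
  · rw [barrier]; linarith [sq_nonneg (z 0 - p 0), sq_nonneg (z 1 - p 1)]
  · have l1 := lw.1
    have l2 := lw.2
    rw [lap] at l1 l2 lo
    have q : grd om a b z = dirD (frU om a b) om z ^ 2 + dirD (frC om a b) om z ^ 2 := rfl
    refine le_trans (le_of_eq ?_) (add_nonpos i1 i2)
    have dv : ∀ r t : ℝ, (r * barrier p R z - t ^ 2) / barrier p R z ^ 2 =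
        r / barrier p R z - (t / barrier p R z) ^ 2 := by
      intro r t; field_simp
    rw [lap, dv, dv]
    linear_combination (6 + 2 * (Real.cosh (om z) / Real.sinh (om z))) * lo -
      (2 * dirD (frU om a b) om z * grd om a b z / grd om a b z ^ 2) * l1 -
      (2 * dirD (frC om a b) om z * grd om a b z / grd om a b z ^ 2) * l2 +
      (2 * (1 / Real.sinh (om z) ^ 2) + 2 * (Real.cosh (om z) ^ 2 + Real.sinh (om z) ^ 2) *
        grd om a b z / grd om a b z ^ 2) * q
  · rw [lb, lc.1, lc.2]
    exact neg_lap_barrier_le hm0 hm1 hcs hu hd (by rw [mu] at hm0; linarith)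
  · rw [dirD_barrier, dirD_barrier]
    simp only [frU_zero, frU_one, frC_zero, frC_one]
    exact grad_barrier_le hm0 hm1 hcs hu hd

end MinFrame

lemma mem_closedBall_of_barrier_nonneg {p z : E2} {R : ℝ} (hR : 0 ≤ R) (h : 0 ≤ barrier p R z) :
    z ∈ Metric.closedBall p R := by
  rw [mem_closedBall_iff_norm]
  have := norm_sq_coord (z - p)
  simp only [barrier, PiLp.sub_apply] at h this
  exact (sq_le_sq₀ (norm_nonneg _) hR).1 (by linarith)

lemma barrier_eq (p z : E2) (R : ℝ) : barrier p R z = R ^ 2 - ‖z - p‖ ^ 2 := by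
  simp [barrier, norm_sq_coord]

lemma barrier_nonneg {p z : E2} {R : ℝ} (h : z ∈ Metric.closedBall p R) : 0 ≤ barrier p R z := by
  rw [mem_closedBall_iff_norm] at h
  rw [barrier_eq]
  nlinarith [norm_nonneg (z - p)]

namespace MinFrame

variable {U : Set E2} {om a b : E2 → ℝ}

lemma mono (h : MinFrame U om a b) {W : Set E2} (hW : IsOpen W) (hWU : W ⊆ U) :
    MinFrame W om a b where
  isOpen := hW
  sub z hz := h.sub z (hWU hz)
  smooth_om := h.smooth_om.mono hWU
  smooth_a := h.smooth_a.mono hWU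
  smooth_b := h.smooth_b.mono hWU
  pos z hz := h.pos z (hWU hz)
  unit z hz := h.unit z (hWU hz)
  comm z hz := h.comm z (hWU hz)

/-- The quantity to which the maximum principle is applied. -/
def maxQ (p : E2) (R : ℝ) (om a b : E2 → ℝ) (z : E2) : ℝ :=
  barrier p R z ^ 2 * grd om a b z / (Real.exp (6 * om z) * Real.sinh (om z) ^ 2)

lemma grd_nonneg (om a b : E2 → ℝ) (z : E2) : 0 ≤ grd om a b z := by
  rw [grd]; positivity

lemma norm_frU_le (h : MinFrame U om a b) {z : E2} (hz : z ∈ U) :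
    ‖frU om a b z‖ ≤ Real.cosh (om z) ∧ ‖frC om a b z‖ ≤ Real.cosh (om z) := by
  have hu := h.unit z hz
  have hm := mu_pos (h.sub z hz)
  have hm1 := mu_le z
  have hm2 : mu z ^ 2 ≤ 1 := by nlinarith
  have hc := Real.cosh_pos (om z)
  have hcs := Real.cosh_sq (om z)
  constructor
  · rw [← sq_le_sq₀ (norm_nonneg _) hc.le, norm_sq_coord]
    simp only [frU_zero, frU_one]
    have : mu z ^ 2 * Real.sinh (om z) ^ 2 ≤ 1 * Real.sinh (om z) ^ 2 := by gcongr
    linear_combination this + (mu z ^ 2 * Real.sinh (om z) ^ 2) * hu - hcs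
  · rw [← sq_le_sq₀ (norm_nonneg _) hc.le, norm_sq_coord]
    simp only [frC_zero, frC_one]
    have : mu z ^ 2 * Real.cosh (om z) ^ 2 ≤ 1 * Real.cosh (om z) ^ 2 := by gcongr
    linear_combination this + (mu z ^ 2 * Real.cosh (om z) ^ 2) * hu

/-- The gradient of `om` is controlled near points where `om` is infinite. -/
lemma maxQ_le (h : MinFrame U om a b) {p : E2} {R M : ℝ} (hR1 : R ≤ 1) (hR0 : 0 ≤ R)
    {m : E2 → ℝ} (hm : ContDiffOn ℝ ∞ m U)
    (hms : ∀ z ∈ U, m z * Real.sinh (om z) ^ 2 = 1) {z : E2} (hz : z ∈ U)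
    (hzR : z ∈ Metric.closedBall p R) (hM : ‖fderiv ℝ m z‖ ≤ M) :
    maxQ p R om a b z ≤ M ^ 2 * m z := by
  set s := Real.sinh (om z) with hs
  set c := Real.cosh (om z) with hc
  have hs0 : 0 < s := Real.sinh_pos_iff.2 (h.pos z hz)
  have hc0 : 0 < c := Real.cosh_pos _
  have hM0 : 0 ≤ M := (norm_nonneg _).trans hM
  have hd : ∀ X : E2 → E2, ‖X z‖ ≤ c → |dirD X om z| ≤ M * s ^ 3 / 2 := by
    intro X hX
    have l1 := hasDerivAt_line (ContDiffOn.diffAt h.isOpen hm hz) (X z)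
    have l2 := hasDerivAt_line (ContDiffOn.diffAt h.isOpen h.smooth_om hz) (X z)
    have l3 := l1.mul (l2.sinh.pow 2)
    have hline : Continuous (fun t : ℝ => z + t • X z) := by fun_prop
    have hnear : ∀ᶠ t in 𝓝 (0 : ℝ), z + t • X z ∈ U :=
      hline.continuousAt.eventually_mem (by simpa using h.isOpen.mem_nhds hz)
    have l4 : HasDerivAt (fun t : ℝ => m (z + t • X z) * Real.sinh (om (z + t • X z)) ^ 2) 0 0 := by
      refine (hasDerivAt_const (0 : ℝ) (1 : ℝ)).congr_of_eventuallyEq ?_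
      filter_upwards [hnear] with t ht using hms _ ht
    have e := l3.unique l4
    simp only [zero_smul, add_zero, Pi.pow_apply] at e
    have hmz := hms z hz
    have e2 : dirD X om z * (2 * c) = -(fderiv ℝ m z (X z) * s ^ 3) := by
      rw [dirD]
      have : fderiv ℝ m z (X z) * s ^ 3 + (m z * s ^ 2) * (fderiv ℝ om z (X z) * (2 * c)) = 0 := by
        linear_combination s * e
      rw [hmz] at this
      linarith
    have e3 : |fderiv ℝ m z (X z)| ≤ M * c := by
      rw [← Real.norm_eq_abs]
      exact (ContinuousLinearMap.le_opNorm _ _).trans (by gcongr)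
    have e4 : |dirD X om z| * (2 * c) ≤ (M * s ^ 3 / 2) * (2 * c) := by
      have : |dirD X om z| * (2 * c) = |fderiv ℝ m z (X z)| * s ^ 3 := by
        rw [← abs_of_pos (by positivity : 0 < 2 * c), ← abs_mul, e2, abs_neg, abs_mul,
          abs_of_pos (by positivity : 0 < s ^ 3)]
      rw [this]
      calc _ ≤ M * c * s ^ 3 := by gcongr
        _ = _ := by ring
    exact le_of_mul_le_mul_right e4 (by positivity)
  have hgrd : grd om a b z ≤ M ^ 2 * s ^ 6 / 2 := by
    have h1 := hd _ (h.norm_frU_le hz).1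
    have h2 := hd _ (h.norm_frU_le hz).2
    have h3 := sq_le_sq' (by linarith [neg_abs_le (dirD (frU om a b) om z)])
      ((le_abs_self _).trans h1)
    have h4 := sq_le_sq' (by linarith [neg_abs_le (dirD (frC om a b) om z)])
      ((le_abs_self _).trans h2)
    rw [grd]; linarith
  have hb0 := barrier_nonneg hzR
  have hb1 : barrier p R z ≤ 1 := by
    rw [barrier_eq]; nlinarith [sq_nonneg ‖z - p‖]
  have hb2 : barrier p R z ^ 2 ≤ 1 := pow_le_one₀ hb0 hb1
  have he : s ≤ Real.exp (om z) := by
    rw [hs, Real.sinh_eq]; linarith [Real.exp_pos (om z), Real.exp_pos (-om z)]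
  have he6 : s ^ 6 ≤ Real.exp (6 * om z) := by
    rw [show (6 : ℝ) * om z = ((6 : ℕ) : ℝ) * om z by norm_num, Real.exp_nat_mul]
    gcongr
  have hmz : m z = 1 / s ^ 2 := by
    rw [eq_div_iff (by positivity)]; exact hms z hz
  rw [maxQ, hmz, div_le_iff₀ (by positivity)]
  calc barrier p R z ^ 2 * grd om a b z ≤ 1 * (M ^ 2 * s ^ 6 / 2) := by
        gcongr
        exact grd_nonneg _ _ _ _
    _ ≤ M ^ 2 * s ^ 6 := by nlinarith [mul_nonneg (sq_nonneg M) (pow_pos hs0 6).le]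
    _ ≤ M ^ 2 * Real.exp (6 * om z) := by gcongr
    _ = _ := by rw [← hs]; field_simp

/-- The interior gradient estimate. -/
theorem maxQ_le_const (h : MinFrame U om a b) {p : E2} {R : ℝ} (hR1 : R ≤ 1) (hR0 : 0 ≤ R)
    {m : E2 → ℝ} {Ω : Set E2} (hΩ : IsOpen Ω) (hm : ContDiffOn ℝ ∞ m Ω)
    (hU : ∀ z, z ∈ U ↔ z ∈ Ω ∧ 0 < m z)
    (hms : ∀ z ∈ U, m z * Real.sinh (om z) ^ 2 = 1) (hball : Metric.closedBall p R ⊆ Ω)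
    {z : E2} (hz : z ∈ U) (hzR : z ∈ Metric.closedBall p R) :
    maxQ p R om a b z ≤ 15 := by
  by_contra! hlt
  have hUΩ : U ⊆ Ω := fun z hz => ((hU z).1 hz).1
  obtain ⟨M, hM⟩ := (isCompact_closedBall p R).exists_bound_of_continuousOn
    ((hm.continuousOn_fderiv_of_isOpen hΩ (by simp)).mono hball)
  have hMm : ∀ z ∈ U, z ∈ Metric.closedBall p R → maxQ p R om a b z ≤ M ^ 2 * m z :=
    fun z hz hzR => h.maxQ_le hR1 hR0 (hm.mono hUΩ) hms hz hzR (hM z hzR)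
  set ε := 15 / (M ^ 2 + 1) with hε
  have hε0 : 0 < ε := by positivity
  have hεm : ∀ z ∈ U, z ∈ Metric.closedBall p R → 15 < maxQ p R om a b z → ε < m z := by
    intro z hz hzR h15
    rw [hε, div_lt_iff₀ (by positivity)]
    have := hMm z hz hzR
    have := ((hU z).1 hz).2
    nlinarith
  set K := Metric.closedBall p R ∩ m ⁻¹' Ici ε with hK
  have hKc : IsCompact K := (isCompact_closedBall p R).of_isClosed_subset
    ((hm.continuousOn.mono hball).preimage_isClosed_of_isClosed Metric.isClosed_closedBall
      isClosed_Ici) inter_subset_left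
  have hKU : K ⊆ U := fun z hz => (hU z).2 ⟨hball hz.1, hε0.trans_le hz.2⟩
  have hcont : ContinuousOn (maxQ p R om a b) U := by
    have c1 := (contDiff_barrier p R).continuous.continuousOn (s := U)
    have c2 := h.smooth_grd.continuousOn
    have c3 := h.smooth_om.continuousOn
    refine ((c1.pow 2).mul c2).div
      ((Real.continuous_exp.comp_continuousOn (c3.const_smul (6 : ℝ))).mul
      ((Real.continuous_sinh.comp_continuousOn c3).pow 2)) fun z hz => ?_
    have := Real.sinh_pos_iff.2 (h.pos z hz)
    exact (mul_pos (Real.exp_pos _) (pow_pos this 2)).ne'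
  obtain ⟨x, hxK, hx⟩ := hKc.exists_isMaxOn ⟨z, hzR, (hεm z hz hzR hlt).le⟩ (hcont.mono hKU)
  have hx15 : 15 < maxQ p R om a b x := hlt.trans_le (hx ⟨hzR, (hεm z hz hzR hlt).le⟩)
  have hxU := hKU hxK
  have hxm := hεm x hxU hxK.1 hx15
  have hbx : 0 < barrier p R x := by
    refine lt_of_le_of_ne (barrier_nonneg hxK.1) fun h0 => ?_
    rw [maxQ, ← h0] at hx15; norm_num at hx15
  have hgx : 0 < grd om a b x := by
    refine lt_of_le_of_ne (grd_nonneg _ _ _ _) fun h0 => ?_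
    rw [maxQ, ← h0] at hx15; norm_num at hx15
  set W := (U ∩ barrier p R ⁻¹' Ioi 0) ∩ ((U ∩ grd om a b ⁻¹' Ioi 0) ∩ (Ω ∩ m ⁻¹' Ioi ε)) with hW
  have hWo : IsOpen W :=
    ((contDiff_barrier p R).continuous.continuousOn.isOpen_inter_preimage h.isOpen isOpen_Ioi).inter
      ((h.smooth_grd.continuousOn.isOpen_inter_preimage h.isOpen isOpen_Ioi).inter
        (hm.continuousOn.isOpen_inter_preimage hΩ isOpen_Ioi))
  have hxW : x ∈ W := ⟨⟨hxU, hbx⟩, ⟨hxU, hgx⟩, hUΩ hxU, hxm⟩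
  have hWU : W ⊆ U := fun z hz => hz.1.1
  have hlog : ∀ z ∈ W, logQ (barrier p R) om a b z = Real.log (maxQ p R om a b z) := by
    rintro z ⟨⟨hzU, hb⟩, ⟨-, hg⟩, -⟩
    have hb' : 0 < barrier p R z := hb
    have hg' : 0 < grd om a b z := hg
    have hs := Real.sinh_pos_iff.2 (h.pos z hzU)
    rw [maxQ, logQ, Real.log_div (by positivity) (by positivity),
      Real.log_mul (by positivity) (by positivity), Real.log_mul (by positivity) (by positivity),
      Real.log_exp, Real.log_pow, Real.log_pow]
    push_cast; ring
  have hmax : IsLocalMax (logQ (barrier p R) om a b) x := by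
    filter_upwards [hWo.mem_nhds hxW] with z hzW
    have hb' : 0 < barrier p R z := hzW.1.2
    have hg' : 0 < grd om a b z := hzW.2.1.2
    have hs := Real.sinh_pos_iff.2 (h.pos z hzW.1.1)
    rw [hlog z hzW, hlog x hxW]
    refine Real.log_le_log (by rw [maxQ]; positivity) ?_
    exact hx ⟨mem_closedBall_of_barrier_nonneg hR0 hb'.le, (show ε < m z from hzW.2.2.2).le⟩
  have key := (h.mono hWo hWU).grd_le_of_isLocalMax hR0 hR1 (fun z hz => hz.1.2)
    (fun z hz => hz.2.1.2) hxW hmax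
  have hs := Real.sinh_pos_iff.2 (h.pos x hxU)
  rw [maxQ, lt_div_iff₀ (by positivity)] at hx15
  have he : Real.cosh (om x) ^ 2 ≤ Real.exp (6 * om x) := by
    have h1 : Real.cosh (om x) ≤ Real.exp (om x) := by
      rw [Real.cosh_eq]
      have : Real.exp (-om x) ≤ Real.exp (om x) := Real.exp_le_exp.2 (by linarith [h.pos x hxU])
      linarith
    calc Real.cosh (om x) ^ 2 ≤ Real.exp (om x) ^ 2 := by
          gcongr
      _ = Real.exp (2 * om x) := by rw [← Real.exp_nat_mul]; norm_num
      _ ≤ _ := Real.exp_le_exp.2 (by linarith [h.pos x hxU])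
  nlinarith [mul_le_mul_of_nonneg_right he (sq_nonneg (Real.sinh (om x)))]

end MinFrame

/-! ### The frame of a minimal graph -/

lemma dirD_eq_coord (V : E2 → E2) (f : E2 → ℝ) (z : E2) :
    dirD V f z = V z 0 * fderiv ℝ f z ex + V z 1 * fderiv ℝ f z ey := by
  conv_lhs => rw [dirD, eq_coord (V z)]
  simp

/-- A closed one-form that is constant on two vector fields annihilates their bracket. -/
lemma closed_form_bracket {U : Set E2} (hU : IsOpen U) {V W : E2 → E2} {p q : E2 → ℝ}
    (hV : ContDiffOn ℝ ∞ V U) (hW : ContDiffOn ℝ ∞ W U) (hp : ContDiffOn ℝ ∞ p U)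
    (hq : ContDiffOn ℝ ∞ q U) (hcl : ∀ z ∈ U, fderiv ℝ q z ex = fderiv ℝ p z ey) {c d : ℝ}
    (hVc : ∀ z ∈ U, p z * V z 0 + q z * V z 1 = c)
    (hWc : ∀ z ∈ U, p z * W z 0 + q z * W z 1 = d) {z : E2} (hz : z ∈ U) :
    p z * (dirD V (fun x => W x 0) z - dirD W (fun x => V x 0) z) +
      q z * (dirD V (fun x => W x 1) z - dirD W (fun x => V x 1) z) = 0 := by
  have key : ∀ {X Y : E2 → E2} {k : ℝ}, ContDiffOn ℝ ∞ Y U →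
      (∀ z ∈ U, p z * Y z 0 + q z * Y z 1 = k) →
      dirD X p z * Y z 0 + p z * dirD X (fun x => Y x 0) z +
        (dirD X q z * Y z 1 + q z * dirD X (fun x => Y x 1) z) = 0 := by
    intro X Y k hY hk
    have dY := ContDiffOn.diffAt hU hY hz
    have dp := ContDiffOn.diffAt hU hp hz
    have dq := ContDiffOn.diffAt hU hq hz
    have l1 := hasDerivAt_line dp (X z)
    have l2 := hasDerivAt_line dq (X z)
    have l3 := hasDerivAt_line (f := fun x => Y x 0) (z := z) (by fun_prop) (X z)
    have l4 := hasDerivAt_line (f := fun x => Y x 1) (z := z) (by fun_prop) (X z)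
    have e := dirD_congr (V := X) (g := fun _ => k) hU hz hk
    rw [dirD_congr_deriv (by fun_prop) ((l1.mul l3).add (l2.mul l4))] at e
    simp only [zero_smul, add_zero] at e
    simp only [dirD]
    rw [e]; simp [dirD]
  have k1 := key (X := V) hW hWc
  have k2 := key (X := W) hV hVc
  rw [dirD_eq_coord V p, dirD_eq_coord V q] at k1
  rw [dirD_eq_coord W p, dirD_eq_coord W q] at k2
  have := hcl z hz
  linear_combination k1 - k2 - (V z 0 * W z 1 - V z 1 * W z 0) * this

lemma inner_ex (g : E2) : ⟪g, ex⟫ = g 0 := by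
  rw [ex, EuclideanSpace.inner_single_right]; simp

lemma inner_ey (g : E2) : ⟪g, ey⟫ = g 1 := by
  rw [ey, EuclideanSpace.inner_single_right]; simp

lemma gradient_zero (u : E2 → ℝ) (z : E2) : gradient u z 0 = fderiv ℝ u z ex := by
  rw [← inner_ex, gradient, InnerProductSpace.toDual_symm_apply]

lemma gradient_one (u : E2 → ℝ) (z : E2) : gradient u z 1 = fderiv ℝ u z ey := by
  rw [← inner_ey, gradient, InnerProductSpace.toDual_symm_apply]

/-- The squared hyperbolic slope. -/
def slopeSq (u : E2 → ℝ) (z : E2) : ℝ :=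
  mu z ^ 2 * (fderiv ℝ u z ex ^ 2 + fderiv ℝ u z ey ^ 2)

lemma slopeSq_eq (u : E2 → ℝ) (z : E2) : slopeSq u z = (lam z)⁻¹ ^ 2 * ‖gradient u z‖ ^ 2 := by
  rw [slopeSq, norm_sq_coord, gradient_zero, gradient_one, mu_eq]

lemma slopeSq_nonneg (u : E2 → ℝ) (z : E2) : 0 ≤ slopeSq u z := by
  rw [slopeSq]; positivity

/-- The Euclidean norm of the gradient. -/
def gnorm (u : E2 → ℝ) (z : E2) : ℝ := √(fderiv ℝ u z ex ^ 2 + fderiv ℝ u z ey ^ 2)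

/-- The hyperbolic angle of a graph. -/
def angle (u : E2 → ℝ) (z : E2) : ℝ := Real.arsinh (mu z * gnorm u z)⁻¹

/-- The first component of the gradient direction. -/
def dirX (u : E2 → ℝ) (z : E2) : ℝ := fderiv ℝ u z ex / gnorm u z

/-- The second component of the gradient direction. -/
def dirY (u : E2 → ℝ) (z : E2) : ℝ := fderiv ℝ u z ey / gnorm u z

/-- The region where the gradient does not vanish. -/
def regSet (Ω : Set E2) (u : E2 → ℝ) : Set E2 := {z | z ∈ Ω ∧ 0 < slopeSq u z}

lemma Xfield_apply (u : E2 → ℝ) (z : E2) :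
    Xfield u z 0 = fderiv ℝ u z ex / √(1 + slopeSq u z) ∧
    Xfield u z 1 = fderiv ℝ u z ey / √(1 + slopeSq u z) := by
  rw [Xfield, ← slopeSq_eq]
  simp [gradient_zero, gradient_one, div_eq_inv_mul]

section
variable {Ω : Set E2} {u : E2 → ℝ}

lemma smooth_partial (hΩ : IsOpen Ω) (hu : ContDiffOn ℝ ∞ u Ω) (v : E2) :
    ContDiffOn ℝ ∞ (fun z => fderiv ℝ u z v) Ω :=
  (hu.fderiv_of_isOpen hΩ (by simp)).clm_apply contDiffOn_const

lemma smooth_slopeSq (hΩ : IsOpen Ω) (hu : ContDiffOn ℝ ∞ u Ω) :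
    ContDiffOn ℝ ∞ (slopeSq u) Ω :=
  (contDiff_mu.contDiffOn.pow 2).mul
    (((smooth_partial hΩ hu ex).pow 2).add ((smooth_partial hΩ hu ey).pow 2))

lemma isOpen_regSet (hΩ : IsOpen Ω) (hu : ContDiffOn ℝ ∞ u Ω) : IsOpen (regSet Ω u) :=
  (smooth_slopeSq hΩ hu).continuousOn.isOpen_inter_preimage hΩ isOpen_Ioi

lemma gnorm_pos {z : E2} (hz : z ∈ regSet Ω u) : 0 < gnorm u z := by
  refine Real.sqrt_pos.2 (lt_of_le_of_ne (by positivity) fun h => ?_)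
  have := hz.2
  rw [slopeSq, ← h] at this
  simp at this

lemma gnorm_sq (u : E2 → ℝ) (z : E2) :
    gnorm u z ^ 2 = fderiv ℝ u z ex ^ 2 + fderiv ℝ u z ey ^ 2 :=
  Real.sq_sqrt (by positivity)

lemma smooth_gnorm (hΩ : IsOpen Ω) (hu : ContDiffOn ℝ ∞ u Ω) :
    ContDiffOn ℝ ∞ (gnorm u) (regSet Ω u) := by
  have hs : regSet Ω u ⊆ Ω := fun z hz => hz.1
  refine ContDiffOn.sqrt ((((smooth_partial hΩ hu ex).pow 2).add
    ((smooth_partial hΩ hu ey).pow 2)).mono hs) fun z hz => ?_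
  have h := gnorm_pos hz
  change fderiv ℝ u z ex ^ 2 + fderiv ℝ u z ey ^ 2 ≠ 0
  rw [← gnorm_sq]; positivity

lemma sinh_angle (u : E2 → ℝ) (z : E2) : Real.sinh (angle u z) = (mu z * gnorm u z)⁻¹ :=
  Real.sinh_arsinh _

lemma cosh_angle (hΩD : Ω ⊆ Disk) {z : E2} (hz : z ∈ regSet Ω u) :
    Real.cosh (angle u z) = √(1 + slopeSq u z) / (mu z * gnorm u z) := by
  have h := gnorm_pos hz
  have hm : 0 < mu z := mu_pos (hΩD hz.1)
  rw [angle, Real.cosh_arsinh]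
  rw [Real.sqrt_eq_iff_mul_self_eq (by positivity) (by positivity)]
  have : √(1 + slopeSq u z) ^ 2 = 1 + slopeSq u z :=
    Real.sq_sqrt (by linarith [slopeSq_nonneg u z])
  field_simp
  rw [this, slopeSq, ← gnorm_sq]
  ring

lemma smooth_sqrt (hΩ : IsOpen Ω) (hu : ContDiffOn ℝ ∞ u Ω) :
    ContDiffOn ℝ ∞ (fun z => √(1 + slopeSq u z)) Ω :=
  ContDiffOn.sqrt (contDiffOn_const.add (smooth_slopeSq hΩ hu)) fun z _ => by
    have := slopeSq_nonneg u z
    positivity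

lemma sqrt_ne (u : E2 → ℝ) (z : E2) : √(1 + slopeSq u z) ≠ 0 := by
  have := slopeSq_nonneg u z
  positivity

lemma IsMinimalGraph.div_eq (h : IsMinimalGraph Ω u) {z : E2} (hz : z ∈ Ω) (hΩ : IsOpen Ω) :
    fderiv ℝ (fun x => fderiv ℝ u x ex / √(1 + slopeSq u x)) z ex +
      fderiv ℝ (fun x => fderiv ℝ u x ey / √(1 + slopeSq u x)) z ey = 0 := by
  have hd := h.2 z hz
  have hS := smooth_sqrt hΩ h.1
  have hX : ContDiffOn ℝ ∞ (Xfield u) Ω := by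
    have e : Xfield u = fun x => (fderiv ℝ u x ex / √(1 + slopeSq u x)) • ex +
        (fderiv ℝ u x ey / √(1 + slopeSq u x)) • ey := by
      funext x
      rw [eq_coord (Xfield u x), (Xfield_apply u x).1, (Xfield_apply u x).2]
    rw [e]
    exact (((smooth_partial hΩ h.1 ex).div hS fun x _ => sqrt_ne u x).smul contDiffOn_const).add
      (((smooth_partial hΩ h.1 ey).div hS fun x _ => sqrt_ne u x).smul contDiffOn_const)
  have dX := ContDiffOn.diffAt hΩ hX hz
  rw [div0, Fin.sum_univ_two, fderiv_coord_comp dX, fderiv_coord_comp dX] at hd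
  simp only [Xfield_apply] at hd
  exact hd

lemma partial_symm (hΩ : IsOpen Ω) (hu : ContDiffOn ℝ ∞ u Ω) {z : E2} (hz : z ∈ Ω) :
    fderiv ℝ (fun x => fderiv ℝ u x ey) z ex = fderiv ℝ (fun x => fderiv ℝ u x ex) z ey :=
  dirD_comm (V := fun _ => ex) (W := fun _ => ey) hΩ contDiffOn_const contDiffOn_const hu hz
    fun i => by simp [dirD]

lemma eq_zero_of_system {x y S : ℝ} {D E : Fin 2 → ℝ} (hg : x ^ 2 + y ^ 2 ≠ 0) (hS : S ≠ 0)
    (h1 : x * (D 0 - E 0) + y * (D 1 - E 1) = 0)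
    (h2 : -(y / S) * (D 0 - E 0) + x / S * (D 1 - E 1) = 0) (i : Fin 2) : D i = E i := by
  field_simp at h2
  have k0 : (x ^ 2 + y ^ 2) * (D 0 - E 0) = 0 := by linear_combination x * h1 - y * h2
  have k1 : (x ^ 2 + y ^ 2) * (D 1 - E 1) = 0 := by linear_combination y * h1 + x * h2
  fin_cases i
  · exact sub_eq_zero.1 ((mul_eq_zero.1 k0).resolve_left hg)
  · exact sub_eq_zero.1 ((mul_eq_zero.1 k1).resolve_left hg)

/-- The frame of a minimal graph. -/
theorem IsMinimalGraph.minFrame (h : IsMinimalGraph Ω u) (hΩ : IsOpen Ω) (hΩD : Ω ⊆ Disk) :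
    MinFrame (regSet Ω u) (angle u) (dirX u) (dirY u) := by
  have hu := h.1
  have hs : regSet Ω u ⊆ Ω := fun z hz => hz.1
  have hg := smooth_gnorm hΩ hu
  have hp := (smooth_partial hΩ hu ex).mono hs
  have hq := (smooth_partial hΩ hu ey).mono hs
  have hU := isOpen_regSet hΩ hu
  have s1 : ContDiffOn ℝ ∞ (angle u) (regSet Ω u) := by
    refine Real.contDiff_arsinh.comp_contDiffOn
      ((contDiff_mu.contDiffOn.mul hg).inv fun z hz => ?_)
    exact (mul_pos (mu_pos (hΩD hz.1)) (gnorm_pos hz)).ne'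
  have s2 : ContDiffOn ℝ ∞ (dirX u) (regSet Ω u) := hp.div hg fun z hz => (gnorm_pos hz).ne'
  have s3 : ContDiffOn ℝ ∞ (dirY u) (regSet Ω u) := hq.div hg fun z hz => (gnorm_pos hz).ne'
  have unit : ∀ z ∈ regSet Ω u, dirX u z ^ 2 + dirY u z ^ 2 = 1 := by
    intro z hz
    have h1 := gnorm_pos hz
    rw [dirX, dirY, div_pow, div_pow, ← add_div, ← gnorm_sq, div_self (by positivity)]
  have e1 : ∀ z ∈ regSet Ω u, fderiv ℝ u z ex = gnorm u z * dirX u z := fun z hz => by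
    have h1 := gnorm_pos hz
    rw [dirX]; field_simp
  have e2 : ∀ z ∈ regSet Ω u, fderiv ℝ u z ey = gnorm u z * dirY u z := fun z hz => by
    have h1 := gnorm_pos hz
    rw [dirY]; field_simp
  have hS := (smooth_sqrt hΩ hu).mono hs
  have hV := contDiffOn_frU s1 s2 s3
  have hW := contDiffOn_frC s1 s2 s3
  refine ⟨hU, fun z hz => hΩD hz.1, s1, s2, s3, fun z hz => ?_, unit, fun z hz i => ?_⟩
  · exact Real.arsinh_pos_iff.2 (inv_pos.2 (mul_pos (mu_pos (hΩD hz.1)) (gnorm_pos hz)))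
  have c1 := closed_form_bracket (c := 1) (d := 0) hU hV hW hp hq (fun z hz => ?_)
    (fun z hz => ?_) (fun z hz => ?_) hz
  · have c2 := closed_form_bracket (p := fun z => -(fderiv ℝ u z ey / √(1 + slopeSq u z)))
      (q := fun z => fderiv ℝ u z ex / √(1 + slopeSq u z)) (c := 0) (d := 1)
      hU hV hW (hq.div hS fun z _ => sqrt_ne u z).neg (hp.div hS fun z _ => sqrt_ne u z)
      (fun z hz => ?_) (fun z hz => ?_) (fun z hz => ?_) hz
    · have hS0 := sqrt_ne u z
      have hg2 : fderiv ℝ u z ex ^ 2 + fderiv ℝ u z ey ^ 2 ≠ 0 := by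
        rw [← gnorm_sq]; exact (pow_pos (gnorm_pos hz) 2).ne'
      exact eq_zero_of_system
        (D := fun i => dirD (frU _ _ _) (fun x => frC (angle u) (dirX u) (dirY u) x i) z)
        (E := fun i => dirD (frC _ _ _) (fun x => frU (angle u) (dirX u) (dirY u) x i) z)
        hg2 hS0 c1 c2 i
    · have := h.div_eq hz.1 hΩ
      rw [fderiv_fun_neg]
      simp only [_root_.neg_apply]
      linarith
    · simp only [frU_zero, frU_one, e1 z hz, e2 z hz]
      ring
    · have hm : 0 < mu z := mu_pos (hΩD hz.1)
      have h1 := gnorm_pos hz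
      have hS0 := sqrt_ne u z
      simp only [frC_zero, frC_one, e1 z hz, e2 z hz, cosh_angle hΩD hz]
      field_simp
      linarith [unit z hz]
  · exact partial_symm hΩ hu hz.1
  · have hm : 0 < mu z := mu_pos (hΩD hz.1)
    have h1 := gnorm_pos hz
    simp only [frU_zero, frU_one, e1 z hz, e2 z hz, sinh_angle]
    field_simp
    linarith [unit z hz]
  · simp only [frC_zero, frC_one, e1 z hz, e2 z hz]
    ring

end

/-! ### Propagation of steepness along geodesics -/

/-- Rotation by a right angle. -/
def rot (n : E2) : E2 := (-n 1) • ex + n 0 • ey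

@[simp] lemma rot_zero (n : E2) : rot n 0 = -n 1 := by simp [rot]
@[simp] lemma rot_one (n : E2) : rot n 1 = n 0 := by simp [rot]

lemma eq_of_coord {v w : E2} (h0 : v 0 = w 0) (h1 : v 1 = w 1) : v = w := by
  rw [eq_coord v, eq_coord w, h0, h1]

lemma HasDerivAt.coord {f : ℝ → E2} {f' : E2} {t : ℝ} (h : HasDerivAt f f' t) (i : Fin 2) :
    HasDerivAt (fun s => f s i) (f' i) t :=
  (EuclideanSpace.proj i : E2 →L[ℝ] ℝ).hasFDerivAt.comp_hasDerivAt t h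

/-- `q` is, up to the speed `κ`, a hyperbolic geodesic with Euclidean unit normal `n`. -/
structure GeodAt (q n : ℝ → E2) (κ t : ℝ) : Prop where
  unit : n t 0 ^ 2 + n t 1 ^ 2 = 1
  pos : HasDerivAt q ((κ * mu (q t)) • rot (n t)) t
  normal : HasDerivAt n (-(κ * (q t 0 * n t 0 + q t 1 * n t 1)) • rot (n t)) t

lemma tilt_algebra {B c d s C w1 w2 : ℝ} (hB : 0 ≤ B) (hcd : c ^ 2 + d ^ 2 = 1)
    (hCs : C ^ 2 = 1 + s ^ 2) (hs : 0 < s) (hC : 0 < C) (hc : 0 < c)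
    (h1 : |w1| ≤ B * s) (h2 : |w2| ≤ B * s) :
    |d ^ 2 * w2 / (s * C) - 2 * c * d * w1 / C ^ 2 - c ^ 2 * s * w2 / C ^ 3| ≤
      8 * B * (1 - c / C) := by
  have hC1 : 1 ≤ C := by
    by_contra! h; nlinarith
  obtain ⟨x, rfl⟩ : ∃ x, w1 = x * s := ⟨w1 / s, by field_simp⟩
  obtain ⟨y, rfl⟩ : ∃ y, w2 = y * s := ⟨w2 / s, by field_simp⟩
  have hx : |x| ≤ B := by
    rw [abs_mul, abs_of_pos hs] at h1; exact le_of_mul_le_mul_right h1 hs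
  have hy : |y| ≤ B := by
    rw [abs_mul, abs_of_pos hs] at h2; exact le_of_mul_le_mul_right h2 hs
  obtain ⟨T, hT⟩ : ∃ T, T = s / C := ⟨_, rfl⟩
  obtain ⟨r, hr⟩ : ∃ r, r = 1 / C := ⟨_, rfl⟩
  have hTr : T ^ 2 + r ^ 2 = 1 := by
    rw [hT, hr]; field_simp; linarith
  have hr0 : 0 < r := by rw [hr]; positivity
  have hr1 : r ≤ 1 := by rw [hr, div_le_one hC]; exact hC1
  have hT0 : 0 < T := by rw [hT]; positivity
  have e : d ^ 2 * (y * s) / (s * C) - 2 * c * d * (x * s) / C ^ 2 - c ^ 2 * s * (y * s) / C ^ 3 =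
      r * (d ^ 2 * y - 2 * c * d * x * T - c ^ 2 * y * T ^ 2) := by
    rw [hT, hr]; field_simp
  have e2 : c / C = c * r := by rw [hr]; ring
  have hc1 : c ≤ 1 := by
    by_contra! h; nlinarith [sq_nonneg d]
  have hcr1 : c * r ≤ c := mul_le_of_le_one_right hc.le hr1
  have hcr2 : c * r ≤ r := mul_le_of_le_one_left hr0.le hc1
  have hd1 : d ^ 2 ≤ 2 * (1 - c * r) := by linarith [sq_nonneg (1 - c)]
  have hT1 : T ^ 2 ≤ 2 * (1 - c * r) := by linarith [sq_nonneg (1 - r)]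
  have a1 : |d ^ 2 * y| ≤ d ^ 2 * B := by
    rw [abs_mul, abs_of_nonneg (sq_nonneg d)]; gcongr
  have a2 : |2 * c * d * x * T| ≤ (d ^ 2 + T ^ 2) * B := by
    have : |2 * c * d * x * T| = c * (2 * |d| * T) * |x| := by
      rw [abs_mul, abs_mul, abs_mul, abs_mul, abs_of_pos hT0, abs_of_pos hc]; norm_num; ring
    rw [this]
    have h3 : 2 * |d| * T ≤ d ^ 2 + T ^ 2 := by
      rw [← sq_abs d]; nlinarith [sq_nonneg (|d| - T)]
    have h4 : c * (2 * |d| * T) ≤ d ^ 2 + T ^ 2 := by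
      have : 0 ≤ 2 * |d| * T := by positivity
      exact (mul_le_of_le_one_left this hc1).trans h3
    gcongr
  have a3 : |c ^ 2 * y * T ^ 2| ≤ T ^ 2 * B := by
    rw [abs_mul, abs_mul, abs_of_nonneg (sq_nonneg c), abs_of_nonneg (sq_nonneg T)]
    have : c ^ 2 * |y| ≤ 1 * B := by
      gcongr
      linarith [sq_nonneg d]
    calc c ^ 2 * |y| * T ^ 2 ≤ 1 * B * T ^ 2 := by gcongr
      _ = T ^ 2 * B := by ring
  have a4 : |d ^ 2 * y - 2 * c * d * x * T - c ^ 2 * y * T ^ 2| ≤ 8 * B * (1 - c * r) := by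
    have := abs_sub (d ^ 2 * y - 2 * c * d * x * T) (c ^ 2 * y * T ^ 2)
    have := abs_sub (d ^ 2 * y) (2 * c * d * x * T)
    have : (d ^ 2 + T ^ 2) * B ≤ (4 * (1 - c * r)) * B :=
      mul_le_mul_of_nonneg_right (by linarith) hB
    linarith
  rw [e, e2, abs_mul, abs_of_pos hr0]
  exact (mul_le_of_le_one_left (abs_nonneg _) hr1).trans a4

namespace MinFrame

variable {U : Set E2} {om a b : E2 → ℝ} {q n : ℝ → E2} {κ t : ℝ}

lemma fderiv_rot (h : MinFrame U om a b) {z m : E2} (hz : z ∈ U) (f : E2 → ℝ) :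
    fderiv ℝ f z ((κ * mu z) • rot m) =
      κ * ((b z * m 0 - a z * m 1) * (dirD (frU om a b) f z / Real.sinh (om z)) +
        (a z * m 0 + b z * m 1) * (dirD (frC om a b) f z / Real.cosh (om z))) := by
  have hs : Real.sinh (om z) ≠ 0 := (Real.sinh_pos_iff.2 (h.pos z hz)).ne'
  have hC : Real.cosh (om z) ≠ 0 := (Real.cosh_pos _).ne'
  have hu := h.unit z hz
  have e : (κ * mu z) • rot m =
      (κ * (b z * m 0 - a z * m 1) / Real.sinh (om z)) • frU om a b z +
        (κ * (a z * m 0 + b z * m 1) / Real.cosh (om z)) • frC om a b z := by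
    apply eq_of_coord
    · simp
      field_simp
      linear_combination (κ * mu z * m 1) * hu
    · simp
      field_simp
      linear_combination (-κ * mu z * m 0) * hu
  rw [e]
  simp only [map_add, map_smul, dirD, smul_eq_mul]
  ring

lemma hasDerivAt_along (h : MinFrame U om a b) (hg : GeodAt q n κ t) (hz : q t ∈ U) :
    HasDerivAt (fun s => (a (q s) * n s 0 + b (q s) * n s 1) / Real.cosh (om (q s)))
      (κ * ((b (q t) * n t 0 - a (q t) * n t 1) ^ 2 * dirD (frC om a b) om (q t) /
          (Real.sinh (om (q t)) * Real.cosh (om (q t))) -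
        2 * (a (q t) * n t 0 + b (q t) * n t 1) * (b (q t) * n t 0 - a (q t) * n t 1) *
          dirD (frU om a b) om (q t) / Real.cosh (om (q t)) ^ 2 -
        (a (q t) * n t 0 + b (q t) * n t 1) ^ 2 * Real.sinh (om (q t)) *
          dirD (frC om a b) om (q t) / Real.cosh (om (q t)) ^ 3)) t := by
  have hs : Real.sinh (om (q t)) ≠ 0 := (Real.sinh_pos_iff.2 (h.pos _ hz)).ne'
  have hC : Real.cosh (om (q t)) ≠ 0 := (Real.cosh_pos _).ne'
  have hu := h.unit _ hz
  have key : ∀ {f : E2 → ℝ}, ContDiffOn ℝ ∞ f U → HasDerivAt (fun s => f (q s)) _ t :=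
    fun hf => ((ContDiffOn.diffAt h.isOpen hf hz).hasFDerivAt.comp_hasDerivAt t hg.pos).congr_deriv
      (h.fderiv_rot hz _)
  have ka := key h.smooth_a
  have kb := key h.smooth_b
  have ko := (key h.smooth_om).cosh
  have n0 := hg.normal.coord 0
  have n1 := hg.normal.coord 1
  refine (((ka.mul n0).add (kb.mul n1)).div ko hC).congr_deriv ?_
  rw [h.dirD_a hz, h.dirD_b hz, h.dirD_a hz, h.dirD_b hz, (h.turn_eq hz).1, (h.turn_eq hz).2]
  simp only [PiLp.smul_apply, rot_zero, rot_one, smul_eq_mul, Pi.add_apply, Pi.mul_apply]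
  generalize b (q t) = B at *
  generalize a (q t) = A at *
  generalize Real.sinh (om (q t)) = S at *
  generalize Real.cosh (om (q t)) = C at *
  field_simp
  linear_combination (κ * C ^ 2 * S * (B * n t 0 - A * n t 1) *
    (q t 0 * n t 0 + q t 1 * n t 1)) * hu

end MinFrame

/-- The component along `m` of the normalised hyperbolic gradient of `u`. -/
def tilt (u : E2 → ℝ) (z m : E2) : ℝ :=
  mu z * (fderiv ℝ u z ex * m 0 + fderiv ℝ u z ey * m 1) / √(1 + slopeSq u z)

section
variable {Ω : Set E2} {u : E2 → ℝ}

lemma tilt_eq (hΩD : Ω ⊆ Disk) {z : E2} (hz : z ∈ regSet Ω u) (m : E2) :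
    tilt u z m = (dirX u z * m 0 + dirY u z * m 1) / Real.cosh (angle u z) := by
  have hm : 0 < mu z := mu_pos (hΩD hz.1)
  have h1 := gnorm_pos hz
  have hS0 := sqrt_ne u z
  rw [tilt, cosh_angle hΩD hz, dirX, dirY]
  field_simp

lemma mem_regSet_of_tilt_pos (hΩD : Ω ⊆ Disk) {z m : E2} (hz : z ∈ Ω) (h : 0 < tilt u z m) :
    z ∈ regSet Ω u := by
  refine ⟨hz, lt_of_le_of_ne (slopeSq_nonneg u z) fun h0 => ?_⟩
  have hm : 0 < mu z := mu_pos (hΩD hz)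
  rw [slopeSq] at h0
  have h1 : fderiv ℝ u z ex ^ 2 + fderiv ℝ u z ey ^ 2 = 0 :=
    (mul_eq_zero.1 h0.symm).resolve_left (by positivity)
  have hx : fderiv ℝ u z ex = 0 := by
    nlinarith [sq_nonneg (fderiv ℝ u z ex), sq_nonneg (fderiv ℝ u z ey)]
  have hy : fderiv ℝ u z ey = 0 := by
    nlinarith [sq_nonneg (fderiv ℝ u z ex), sq_nonneg (fderiv ℝ u z ey)]
  rw [tilt, hx, hy] at h
  simp at h

lemma slopeSq_mul_sinh (hΩD : Ω ⊆ Disk) {z : E2} (hz : z ∈ regSet Ω u) :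
    slopeSq u z * Real.sinh (angle u z) ^ 2 = 1 := by
  have hm : 0 < mu z := mu_pos (hΩD hz.1)
  have h1 := gnorm_pos hz
  rw [sinh_angle, slopeSq, ← gnorm_sq]
  field_simp

/-- Interior gradient estimate for the angle of a minimal graph, where it is steep. -/
lemma IsMinimalGraph.abs_dirD_angle_le (h : IsMinimalGraph Ω u) (hΩ : IsOpen Ω) (hΩD : Ω ⊆ Disk)
    {z : E2} {R : ℝ} (hR0 : 0 < R) (hR1 : R ≤ 1) (hball : Metric.closedBall z R ⊆ Ω)
    (hz : z ∈ regSet Ω u) (hC : Real.cosh (angle u z) ≤ 2) :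
    |dirD (frU (angle u) (dirX u) (dirY u)) (angle u) z| ≤
        256 / R ^ 2 * Real.sinh (angle u z) ∧
      |dirD (frC (angle u) (dirX u) (dirY u)) (angle u) z| ≤
        256 / R ^ 2 * Real.sinh (angle u z) := by
  have hF := h.minFrame hΩ hΩD
  have hs : 0 < Real.sinh (angle u z) := Real.sinh_pos_iff.2 (hF.pos z hz)
  have key := hF.maxQ_le_const hR1 hR0.le hΩ (smooth_slopeSq hΩ h.1) (fun z => Iff.rfl)
    (fun z hz => slopeSq_mul_sinh hΩD hz) hball hz (Metric.mem_closedBall_self hR0.le)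
  have hb : barrier z R z = R ^ 2 := by simp [barrier]
  have he : Real.exp (angle u z) ≤ 4 := by
    have := Real.cosh_sq (angle u z)
    have e : Real.cosh (angle u z) + Real.sinh (angle u z) = Real.exp (angle u z) :=
      Real.cosh_add_sinh _
    nlinarith
  have he6 : Real.exp (6 * angle u z) ≤ 4 ^ 6 := by
    rw [show (6 : ℝ) * angle u z = (6 : ℕ) * angle u z by norm_num, Real.exp_nat_mul]
    exact pow_le_pow_left₀ (Real.exp_pos _).le he 6
  have hp : 0 < Real.exp (6 * angle u z) := Real.exp_pos _
  rw [MinFrame.maxQ, hb, div_le_iff₀ (by positivity)] at key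
  have key2 : (R ^ 2) ^ 2 * MinFrame.grd (angle u) (dirX u) (dirY u) z ≤
      (256 * Real.sinh (angle u z)) ^ 2 := by
    refine key.trans ?_
    have : Real.exp (6 * angle u z) * Real.sinh (angle u z) ^ 2 ≤
      4 ^ 6 * Real.sinh (angle u z) ^ 2 := by gcongr
    linarith [sq_nonneg (Real.sinh (angle u z))]
  have fin : ∀ w : ℝ, w ^ 2 ≤ MinFrame.grd (angle u) (dirX u) (dirY u) z →
      |w| ≤ 256 / R ^ 2 * Real.sinh (angle u z) := by
    intro w hw
    rw [div_mul_eq_mul_div, le_div_iff₀ (by positivity)]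
    refine (sq_le_sq₀ (by positivity) (by positivity)).1 ?_
    rw [mul_pow, sq_abs]
    calc w ^ 2 * (R ^ 2) ^ 2 ≤ MinFrame.grd (angle u) (dirX u) (dirY u) z * (R ^ 2) ^ 2 := by gcongr
      _ ≤ _ := by linarith
  constructor
  · exact fin _ (by
      rw [MinFrame.grd]; linarith [sq_nonneg (dirD (frC (angle u) (dirX u) (dirY u)) (angle u) z)])
  · exact fin _ (by
      rw [MinFrame.grd]; linarith [sq_nonneg (dirD (frU (angle u) (dirX u) (dirY u)) (angle u) z)])

variable {q n : ℝ → E2} {κ t : ℝ}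

lemma GeodAt.differentiableAt_tilt (hg : GeodAt q n κ t) (hΩ : IsOpen Ω)
    (hu : ContDiffOn ℝ ∞ u Ω) (hz : q t ∈ Ω) :
    DifferentiableAt ℝ (fun s => tilt u (q s) (n s)) t := by
  have hq := hg.pos.differentiableAt
  have n0 := (hg.normal.coord 0).differentiableAt
  have n1 := (hg.normal.coord 1).differentiableAt
  have key : ∀ {f : E2 → ℝ}, ContDiffOn ℝ ∞ f Ω → DifferentiableAt ℝ (fun s => f (q s)) t :=
    fun hf => (ContDiffOn.diffAt hΩ hf hz).comp t hq
  have k1 := key contDiff_mu.contDiffOn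
  have k2 := key (smooth_partial hΩ hu ex)
  have k3 := key (smooth_partial hΩ hu ey)
  have k4 := key (smooth_sqrt hΩ hu)
  exact (k1.mul ((k2.mul n0).add (k3.mul n1))).div k4 (sqrt_ne u _)

/-- Where the graph is steep in the direction of the normal of a geodesic, the defect
`1 - tilt` changes at most exponentially along the geodesic. -/
lemma GeodAt.deriv_tilt_le (hg : GeodAt q n κ t) (h : IsMinimalGraph Ω u) (hΩ : IsOpen Ω)
    (hΩD : Ω ⊆ Disk) {R : ℝ} (hR0 : 0 < R) (hR1 : R ≤ 1)
    (hball : Metric.closedBall (q t) R ⊆ Ω) (ht : 1 / 2 ≤ tilt u (q t) (n t)) :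
    |deriv (fun s => tilt u (q s) (n s)) t| ≤
      |κ| * (8 * (256 / R ^ 2) * (1 - tilt u (q t) (n t))) := by
  have hzΩ : q t ∈ Ω := hball (Metric.mem_closedBall_self hR0.le)
  have hz : q t ∈ regSet Ω u := mem_regSet_of_tilt_pos hΩD hzΩ (by linarith)
  have hF := h.minFrame hΩ hΩD
  have hd := hF.hasDerivAt_along hg hz
  have hev : (fun s => tilt u (q s) (n s)) =ᶠ[𝓝 t] fun s =>
      (dirX u (q s) * n s 0 + dirY u (q s) * n s 1) / Real.cosh (angle u (q s)) := by
    filter_upwards [hg.pos.continuousAt.eventually_mem (hF.isOpen.mem_nhds hz)] with s hs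
    exact tilt_eq hΩD hs _
  rw [hev.deriv_eq, hd.deriv, abs_mul]
  rw [tilt_eq hΩD hz] at ht ⊢
  have hu := hF.unit _ hz
  have hn := hg.unit
  have hC := Real.cosh_pos (angle u (q t))
  have hC1 := Real.one_le_cosh (angle u (q t))
  have hcd : (dirX u (q t) * n t 0 + dirY u (q t) * n t 1) ^ 2 +
      (dirY u (q t) * n t 0 - dirX u (q t) * n t 1) ^ 2 = 1 := by
    linear_combination (n t 0 ^ 2 + n t 1 ^ 2) * hu + hn
  rw [le_div_iff₀ hC] at ht
  have hc : 0 < dirX u (q t) * n t 0 + dirY u (q t) * n t 1 := by linarith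
  have hC2 : Real.cosh (angle u (q t)) ≤ 2 := by
    by_contra! hlt
    nlinarith [sq_nonneg (dirY u (q t) * n t 0 - dirX u (q t) * n t 1)]
  obtain ⟨w1, w2⟩ := h.abs_dirD_angle_le hΩ hΩD hR0 hR1 hball hz hC2
  refine mul_le_mul_of_nonneg_left ?_ (abs_nonneg _)
  refine tilt_algebra (by positivity) hcd ?_ (Real.sinh_pos_iff.2 (hF.pos _ hz)) hC hc w1 w2
  rw [Real.cosh_sq]; ring

end

/-- The graphs `u k` become vertical at `p`, with limiting gradient direction `m`. -/
def Steep (u : ℕ → E2 → ℝ) (p m : E2) : Prop := ∀ ε > 0, ∃ k, 1 - ε < tilt (u k) p m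

section
variable {Ω : Set E2}

lemma one_sub_tilt_le {u : E2 → ℝ} (h : IsMinimalGraph Ω u) (hΩ : IsOpen Ω) (hΩD : Ω ⊆ Disk)
    {q n : ℝ → E2} {κ : ℝ → ℝ} {T M R ε : ℝ} (hT : 0 ≤ T) (hR0 : 0 < R) (hR1 : R ≤ 1)
    (hg : ∀ t ∈ Icc 0 T, GeodAt q n (κ t) t) (hκ : ∀ t ∈ Icc 0 T, |κ t| ≤ M)
    (hball : ∀ t ∈ Icc 0 T, Metric.closedBall (q t) R ⊆ Ω)
    (hε : 1 - tilt u (q 0) (n 0) < ε) (hε0 : 0 < ε)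
    (hsmall : ε * Real.exp ((M * (8 * (256 / R ^ 2)) + 1) * T) < 1 / 2) :
    1 - tilt u (q T) (n T) ≤ ε * Real.exp ((M * (8 * (256 / R ^ 2)) + 1) * T) := by
  set K := M * (8 * (256 / R ^ 2)) + 1 with hK
  have hM : 0 ≤ M := (abs_nonneg _).trans (hκ 0 ⟨le_rfl, hT⟩)
  have hK0 : 0 < K := by positivity
  have hΩt : ∀ t ∈ Icc 0 T, q t ∈ Ω := fun t ht => hball t ht (Metric.mem_closedBall_self hR0.le)
  have hd : ∀ t ∈ Icc 0 T, DifferentiableAt ℝ (fun s => 1 - tilt u (q s) (n s)) t := fun t ht =>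
    ((hg t ht).differentiableAt_tilt hΩ h.1 (hΩt t ht)).const_sub 1
  have hB : ∀ t : ℝ, HasDerivAt (fun s => ε * Real.exp (K * s)) (K * (ε * Real.exp (K * t))) t := by
    intro t
    refine (((hasDerivAt_id t).const_mul K).exp.const_mul ε).congr_deriv ?_
    simp; ring
  refine image_le_of_deriv_right_lt_deriv_boundary' (f := fun s => 1 - tilt u (q s) (n s))
    (f' := fun t => deriv (fun s => 1 - tilt u (q s) (n s)) t) (a := 0) (b := T)
    (B := fun s => ε * Real.exp (K * s)) (B' := fun t => K * (ε * Real.exp (K * t)))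
    (fun t ht => (hd t ht).continuousAt.continuousWithinAt)
    (fun t ht => (hd t ⟨ht.1, ht.2.le⟩).hasDerivAt.hasDerivWithinAt) (by simpa using hε.le)
    (fun t _ => (hB t).continuousAt.continuousWithinAt) (fun t _ => (hB t).hasDerivWithinAt)
    (fun t ht heq => ?_) ⟨hT, le_rfl⟩
  have ht' : t ∈ Icc 0 T := ⟨ht.1, ht.2.le⟩
  have hpos : 0 < ε * Real.exp (K * t) := by positivity
  have hle : ε * Real.exp (K * t) ≤ ε * Real.exp (K * T) := by
    have := ht.2.le
    gcongr
  have hhalf : 1 / 2 ≤ tilt u (q t) (n t) := by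
    linarith
  have key := (hg t ht').deriv_tilt_le h hΩ hΩD hR0 hR1 (hball t ht') hhalf
  simp only [deriv_const_sub]
  rw [← heq] at hpos ⊢
  have k2 : |κ t| * (8 * (256 / R ^ 2) * (1 - tilt u (q t) (n t))) ≤
      M * (8 * (256 / R ^ 2) * (1 - tilt u (q t) (n t))) :=
    mul_le_mul_of_nonneg_right (hκ t ht') (by positivity)
  have := neg_abs_le (deriv (fun s => tilt u (q s) (n s)) t)
  rw [hK]
  linarith

theorem Steep.propagate {u : ℕ → E2 → ℝ} (hu : ∀ k, IsMinimalGraph Ω (u k)) (hΩ : IsOpen Ω)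
    (hΩD : Ω ⊆ Disk) {q n : ℝ → E2} {κ : ℝ → ℝ} {T M : ℝ} (hT : 0 ≤ T)
    (hg : ∀ t ∈ Icc 0 T, GeodAt q n (κ t) t) (hκ : ∀ t ∈ Icc 0 T, |κ t| ≤ M)
    (hΩt : ∀ t ∈ Icc 0 T, q t ∈ Ω) (h : Steep u (q 0) (n 0)) : Steep u (q T) (n T) := by
  have hc : ContinuousOn q (Icc 0 T) := fun t ht =>
    (hg t ht).pos.continuousAt.continuousWithinAt
  obtain ⟨δ, hδ, hsub⟩ := (isCompact_Icc.image_of_continuousOn hc).exists_cthickening_subset_open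
    hΩ (by rintro _ ⟨t, ht, rfl⟩; exact hΩt t ht)
  have hball : ∀ t ∈ Icc 0 T, Metric.closedBall (q t) (min δ 1) ⊆ Ω := fun t ht =>
    ((Metric.closedBall_subset_closedBall (min_le_left _ _)).trans
      (Metric.closedBall_subset_cthickening (mem_image_of_mem q ht) δ)).trans hsub
  have hR0 : 0 < min δ 1 := lt_min hδ one_pos
  intro ε hε
  set E := Real.exp ((M * (8 * (256 / min δ 1 ^ 2)) + 1) * T) with hE
  have hE0 : 0 < E := Real.exp_pos _
  have he0 : 0 < min (ε / 2) (1 / 4) / E := by positivity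
  have he : min (ε / 2) (1 / 4) / E * E = min (ε / 2) (1 / 4) := by field_simp
  obtain ⟨k, hk⟩ := h _ he0
  refine ⟨k, ?_⟩
  have := one_sub_tilt_le (hu k) hΩ hΩD hT hR0 (min_le_right _ _) hg hκ hball
    (ε := min (ε / 2) (1 / 4) / E) (by linarith) he0
    (by rw [← hE, he]; exact (min_le_right _ _).trans_lt (by norm_num))
  rw [← hE, he] at this
  have := min_le_left (ε / 2) (1 / 4)
  linarith

lemma tilt_sq_le (u : E2 → ℝ) {z m : E2} (hm : m 0 ^ 2 + m 1 ^ 2 = 1) :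
    tilt u z m ^ 2 * (1 + slopeSq u z) ≤ slopeSq u z := by
  have h0 := slopeSq_nonneg u z
  have hS : √(1 + slopeSq u z) ^ 2 = 1 + slopeSq u z := Real.sq_sqrt (by linarith)
  rw [tilt, div_pow, hS, div_mul_cancel₀ _ (by positivity), mul_pow]
  rw [slopeSq]
  gcongr
  nlinarith [sq_nonneg (fderiv ℝ u z ex * m 1 - fderiv ℝ u z ey * m 0)]

lemma Steep.mem_divergenceSet {u : ℕ → E2 → ℝ} (hΩD : Ω ⊆ Disk) {z m : E2} (hz : z ∈ Ω)
    (hm : m 0 ^ 2 + m 1 ^ 2 = 1) (h : Steep u z m) : z ∈ DivergenceSet Ω u := by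
  refine ⟨hz, ?_⟩
  rintro ⟨C, hC⟩
  have hmu : 0 < mu z := mu_pos (hΩD hz)
  set S := mu z ^ 2 * C ^ 2 with hS
  have hS0 : 0 ≤ S := by positivity
  have hle : ∀ k, slopeSq (u k) z ≤ S := fun k => by
    rw [slopeSq_eq, ← mu_eq, hS]
    gcongr
    exact hC k
  obtain ⟨k, hk⟩ := h (1 / (2 * (1 + S))) (by positivity)
  have h1 := tilt_sq_le (u k) (z := z) hm
  have h2 := hle k
  have h3 := slopeSq_nonneg (u k) z
  have h4 : 1 / (2 * (1 + S)) * (1 + S) = 1 / 2 := by field_simp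
  have h5 : (1 - 1 / (2 * (1 + S))) ^ 2 < tilt (u k) z m ^ 2 := by
    have : 1 / (2 * (1 + S)) ≤ 1 := by
      rw [div_le_one (by positivity)]; linarith
    have : 0 ≤ 1 - 1 / (2 * (1 + S)) := by linarith
    gcongr
  set x := 1 / (2 * (1 + S))
  have hx : 0 < x := by positivity
  have h6 : (1 - x) ^ 2 * (1 + slopeSq (u k) z) < slopeSq (u k) z :=
    (mul_lt_mul_of_pos_right h5 (by linarith)).trans_le h1
  have h7 : x * (1 + slopeSq (u k) z) ≤ 1 / 2 := by
    rw [← h4]; gcongr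
  nlinarith [sq_nonneg x]

lemma exists_steep {u : ℕ → E2 → ℝ} (hΩD : Ω ⊆ Disk) {z : E2} (h : z ∈ DivergenceSet Ω u) :
    ∃ m : E2, m 0 ^ 2 + m 1 ^ 2 = 1 ∧ Steep u z m := by
  have hz := h.1
  have hmu : 0 < mu z := mu_pos (hΩD hz)
  have hub : ∀ C : ℝ, ∃ k, C < ‖gradient (u k) z‖ := by
    intro C
    by_contra! hC
    exact h.2 ⟨C, hC⟩
  choose k hk using fun j : ℕ => hub j
  let m : ℕ → E2 := fun j => ‖gradient (u (k j)) z‖⁻¹ • gradient (u (k j)) z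
  have hpos : ∀ j, 0 < ‖gradient (u (k j)) z‖ := fun j =>
    (Nat.cast_nonneg j).trans_lt (hk j)
  have hm : ∀ j, m j ∈ Metric.sphere (0 : E2) 1 := fun j => by
    have := hpos j
    simp [m, norm_smul, this.ne']
  obtain ⟨E, hE, φ, hφ, hlim⟩ := (isCompact_sphere (0 : E2) 1).tendsto_subseq hm
  have hE1 : ‖E‖ = 1 := by simpa using hE
  refine ⟨E, by rw [← norm_sq_coord, hE1]; norm_num, ?_⟩
  have hgt : Tendsto (fun j => ‖gradient (u (k (φ j))) z‖) atTop atTop :=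
    tendsto_atTop_mono (fun j => ((Nat.cast_le.2 (hφ.id_le j)).trans (hk (φ j)).le))
      tendsto_natCast_atTop_atTop
  have htilt : ∀ j, tilt (u (k (φ j))) z E =
      (⟪m (φ j), E⟫) / √(1 + ((mu z * ‖gradient (u (k (φ j))) z‖)⁻¹) ^ 2) := by
    intro j
    have hG := hpos (φ j)
    have e1 : ⟪m (φ j), E⟫ = ‖gradient (u (k (φ j))) z‖⁻¹ *
        (fderiv ℝ (u (k (φ j))) z ex * E 0 + fderiv ℝ (u (k (φ j))) z ey * E 1) := by
      rw [real_inner_smul_left, ← gradient_zero, ← gradient_one]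
      conv_lhs => rw [eq_coord E, inner_add_right, real_inner_smul_right, real_inner_smul_right,
        inner_ex, inner_ey]
      ring
    have e2 : √(1 + slopeSq (u (k (φ j))) z) = (mu z * ‖gradient (u (k (φ j))) z‖) *
        √(1 + ((mu z * ‖gradient (u (k (φ j))) z‖)⁻¹) ^ 2) := by
      rw [slopeSq_eq, ← mu_eq, ← Real.sqrt_sq (mul_pos hmu hG).le, ← Real.sqrt_mul (sq_nonneg _)]
      congr 1
      rw [Real.sqrt_sq (mul_pos hmu hG).le]
      field_simp
      ring
    have h0 : 0 < √(1 + ((mu z * ‖gradient (u (k (φ j))) z‖)⁻¹) ^ 2) := by positivity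
    rw [tilt, e1, e2]
    field_simp
  have hl : Tendsto (fun j => tilt (u (k (φ j))) z E) atTop (𝓝 (⟪E, E⟫ / √(1 + 0 ^ 2))) := by
    simp only [htilt]
    refine Tendsto.div (hlim.inner tendsto_const_nhds) ?_ (by simp)
    refine (Tendsto.add tendsto_const_nhds (Tendsto.pow ?_ 2)).sqrt
    exact (hgt.const_mul_atTop hmu).inv_tendsto_atTop
  intro ε hε
  rw [real_inner_self_eq_norm_sq, hE1] at hl
  have := hl.eventually (lt_mem_nhds (show 1 - ε < 1 ^ 2 / √(1 + 0 ^ 2) by norm_num; exact hε))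
  obtain ⟨j, hj⟩ := this.exists
  exact ⟨_, hj⟩

end

/-! ### Explicit geodesics -/

/-- Squared modulus of the denominator of a disk automorphism along a diameter. -/
def geoD (α β t : ℝ) : ℝ := (1 + t * α) ^ 2 + (t * β) ^ 2

/-- Real part of the geodesic through `α - iβ` with initial direction `1`. -/
def geoA (α β t : ℝ) : ℝ := ((α + t) * (1 + t * α) - t * β ^ 2) / geoD α β t

/-- Imaginary part of the geodesic through `α - iβ` with initial direction `1`. -/
def geoB (α β t : ℝ) : ℝ := -(β * (1 + 2 * t * α + t ^ 2)) / geoD α β t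

/-- Real part of the direction of that geodesic. -/
def dirA (α β t : ℝ) : ℝ := ((1 + t * α) ^ 2 - (t * β) ^ 2) / geoD α β t

/-- Imaginary part of the direction of that geodesic. -/
def dirB (α β t : ℝ) : ℝ := -(2 * (1 + t * α) * (t * β)) / geoD α β t

/-- The geodesic with initial direction `v`; its initial point is `v * (α - iβ)` as a complex
number. -/
def geo (v : E2) (α β t : ℝ) : E2 :=
  (v 0 * geoA α β t - v 1 * geoB α β t) • ex + (v 0 * geoB α β t + v 1 * geoA α β t) • ey

/-- The Euclidean unit normal along `geo`. -/
def geoNormal (v : E2) (α β t : ℝ) : E2 :=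
  (v 0 * dirB α β t + v 1 * dirA α β t) • ex + (v 1 * dirB α β t - v 0 * dirA α β t) • ey

section
variable {v : E2} {α β t : ℝ}

lemma geoD_pos (hr : α ^ 2 + β ^ 2 < 1) (ht : t ∈ Icc (-1 : ℝ) 1) : 0 < geoD α β t := by
  have ht2 : t ^ 2 ≤ 1 := by nlinarith [ht.1, ht.2]
  rw [geoD]
  by_contra! h
  have h1 : 1 + t * α = 0 := by nlinarith [sq_nonneg (1 + t * α), sq_nonneg (t * β)]
  have h2 : t ^ 2 * α ^ 2 = 1 := by linear_combination (t * α - 1) * h1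
  nlinarith [sq_nonneg α, sq_nonneg β]

lemma one_sub_geo (hD : geoD α β t ≠ 0) :
    1 - (geoA α β t ^ 2 + geoB α β t ^ 2) =
      (1 - (α ^ 2 + β ^ 2)) * (1 - t ^ 2) / geoD α β t := by
  rw [geoA, geoB]
  field_simp
  rw [geoD]; ring

lemma dir_unit (hD : geoD α β t ≠ 0) : dirA α β t ^ 2 + dirB α β t ^ 2 = 1 := by
  rw [dirA, dirB]
  field_simp
  rw [geoD]; ring

lemma geo_dir (hD : geoD α β t ≠ 0) :
    geoA α β t * dirB α β t - geoB α β t * dirA α β t = β * (1 - t ^ 2) / geoD α β t := by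
  rw [geoA, geoB, dirA, dirB]
  field_simp
  rw [geoD]; ring

lemma hasDerivAt_geoD : HasDerivAt (geoD α β) (2 * (1 + t * α) * α + 2 * (t * β) * β) t := by
  have h1 := ((hasDerivAt_id t).mul_const α).const_add 1
  have h2 := (hasDerivAt_id t).mul_const β
  refine ((h1.pow 2).add (h2.pow 2)).congr_deriv ?_
  simp

lemma hasDerivAt_geoA (hD : geoD α β t ≠ 0) :
    HasDerivAt (geoA α β) ((1 - (α ^ 2 + β ^ 2)) * dirA α β t / geoD α β t) t := by
  have h1 := ((hasDerivAt_id t).mul_const α).const_add 1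
  have h2 := (hasDerivAt_id t).const_add α
  have h3 := (hasDerivAt_id t).mul_const (β ^ 2)
  refine (((h2.mul h1).sub h3).div hasDerivAt_geoD hD).congr_deriv ?_
  simp only [id, dirA, Pi.mul_apply, Pi.sub_apply]
  field_simp
  rw [geoD]; ring

lemma hasDerivAt_geoB (hD : geoD α β t ≠ 0) :
    HasDerivAt (geoB α β) ((1 - (α ^ 2 + β ^ 2)) * dirB α β t / geoD α β t) t := by
  have h1 := (((hasDerivAt_id t).const_mul 2).mul_const α).const_add 1
  have h2 := ((h1.add ((hasDerivAt_id t).pow 2)).const_mul β).neg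
  refine (h2.div hasDerivAt_geoD hD).congr_deriv ?_
  simp only [id, dirB, Pi.neg_apply, Pi.add_apply, Pi.pow_apply]
  field_simp
  rw [geoD]; ring

lemma hasDerivAt_dirA (hD : geoD α β t ≠ 0) :
    HasDerivAt (dirA α β) (2 * β * dirB α β t / geoD α β t) t := by
  have h1 := ((hasDerivAt_id t).mul_const α).const_add 1
  have h2 := (hasDerivAt_id t).mul_const β
  refine (((h1.pow 2).sub (h2.pow 2)).div hasDerivAt_geoD hD).congr_deriv ?_
  simp only [id, dirB, Pi.sub_apply, Pi.pow_apply]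
  field_simp
  rw [geoD]; ring

lemma hasDerivAt_dirB (hD : geoD α β t ≠ 0) :
    HasDerivAt (dirB α β) (-(2 * β * dirA α β t) / geoD α β t) t := by
  have h1 := ((hasDerivAt_id t).mul_const α).const_add 1
  have h2 := (hasDerivAt_id t).mul_const β
  refine ((((h1.const_mul 2).mul h2).neg).div hasDerivAt_geoD hD).congr_deriv ?_
  simp only [id, dirA, Pi.neg_apply, Pi.mul_apply]
  field_simp
  rw [geoD]; ring

lemma norm_sq_geo (hv : v 0 ^ 2 + v 1 ^ 2 = 1) :
    geo v α β t 0 ^ 2 + geo v α β t 1 ^ 2 = geoA α β t ^ 2 + geoB α β t ^ 2 := by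
  simp [geo]
  linear_combination (geoA α β t ^ 2 + geoB α β t ^ 2) * hv

lemma continuousAt_geo (hr : α ^ 2 + β ^ 2 < 1) (ht : t ∈ Icc (-1 : ℝ) 1) :
    ContinuousAt (geo v α β) t := by
  have hD := (geoD_pos hr ht).ne'
  have h1 := (hasDerivAt_geoA hD).continuousAt
  have h2 := (hasDerivAt_geoB hD).continuousAt
  unfold geo
  fun_prop

lemma geodAt_geo (hv : v 0 ^ 2 + v 1 ^ 2 = 1) (hr : α ^ 2 + β ^ 2 < 1)
    (ht : t ∈ Ioo (-1 : ℝ) 1) : GeodAt (geo v α β) (geoNormal v α β) (2 / (1 - t ^ 2)) t := by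
  have hD := (geoD_pos hr ⟨ht.1.le, ht.2.le⟩).ne'
  have ht2 : 1 - t ^ 2 ≠ 0 := by nlinarith [ht.1, ht.2]
  have hA := hasDerivAt_geoA hD
  have hB := hasDerivAt_geoB hD
  have hdA := hasDerivAt_dirA hD
  have hdB := hasDerivAt_dirB hD
  refine ⟨?_, ?_, ?_⟩
  · simp only [geoNormal, PiLp.add_apply, PiLp.smul_apply, ex_zero, ex_one, ey_zero, ey_one,
      smul_eq_mul, mul_one, mul_zero, add_zero, zero_add]
    linear_combination (dirA α β t ^ 2 + dirB α β t ^ 2) * hv + dir_unit hD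
  · have hmu : 2 / (1 - t ^ 2) * mu (geo v α β t) = (1 - (α ^ 2 + β ^ 2)) / geoD α β t := by
      rw [mu, norm_sq_geo hv, one_sub_geo hD]
      field_simp
    rw [hmu]
    refine ((((hA.const_mul (v 0)).sub (hB.const_mul (v 1))).smul_const ex).add
      (((hB.const_mul (v 0)).add (hA.const_mul (v 1))).smul_const ey)).congr_deriv ?_
    apply eq_of_coord
    · simp [geoNormal]; ring
    · simp [geoNormal]; ring
  · have hin : 2 / (1 - t ^ 2) * (geo v α β t 0 * geoNormal v α β t 0 +
        geo v α β t 1 * geoNormal v α β t 1) = 2 * β / geoD α β t := by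
      have : geo v α β t 0 * geoNormal v α β t 0 + geo v α β t 1 * geoNormal v α β t 1 =
          β * (1 - t ^ 2) / geoD α β t := by
        rw [← geo_dir hD]
        simp [geo, geoNormal]
        linear_combination (geoA α β t * dirB α β t - geoB α β t * dirA α β t) * hv
      rw [this]
      field_simp
    rw [hin]
    refine ((((hdB.const_mul (v 0)).add (hdA.const_mul (v 1))).smul_const ex).add
      (((hdB.const_mul (v 1)).sub (hdA.const_mul (v 0))).smul_const ey)).congr_deriv ?_
    apply eq_of_coord
    · simp [geoNormal]; ring
    · simp [geoNormal]; ring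

lemma GeodAt.comp_neg {q n : ℝ → E2} {κ t : ℝ} (h : GeodAt q n κ (-t)) :
    GeodAt (fun s => q (-s)) (fun s => n (-s)) (-κ) t := by
  refine ⟨h.unit, ?_, ?_⟩
  · refine (h.pos.scomp t (hasDerivAt_neg t)).congr_deriv ?_
    simp
  · refine (h.normal.scomp t (hasDerivAt_neg t)).congr_deriv ?_
    simp

end

/-! ### Geodesics in the Klein model -/

section
variable {v : E2} {α β t : ℝ}

/-- The denominator of the affine parameter of a geodesic in the Klein model. -/
def kleinD (α β t : ℝ) : ℝ := (1 + (α ^ 2 + β ^ 2)) * (1 + t ^ 2) + 4 * t * α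

/-- The affine parameter of a geodesic in the Klein model. -/
def kleinT (α β t : ℝ) : ℝ := 2 * t / kleinD α β t

lemma kleinD_eq : kleinD α β t = geoD α β t + ((α + t) ^ 2 + β ^ 2) := by
  rw [kleinD, geoD]; ring

lemma kleinD_pos (hr : α ^ 2 + β ^ 2 < 1) (ht : t ∈ Icc (-1 : ℝ) 1) : 0 < kleinD α β t := by
  have := geoD_pos hr ht
  rw [kleinD_eq]; positivity

lemma kleinT_strictMonoOn (hr : α ^ 2 + β ^ 2 < 1) :
    StrictMonoOn (kleinT α β) (Icc (-1 : ℝ) 1) := by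
  intro s hs t ht hst
  rw [kleinT, kleinT, div_lt_div_iff₀ (kleinD_pos hr hs) (kleinD_pos hr ht), kleinD, kleinD]
  have h1 : 0 < 1 - s * t := by
    by_contra! h
    nlinarith [hs.1, hs.2, ht.1, ht.2]
  have h2 : 0 < (1 + (α ^ 2 + β ^ 2)) * (t - s) * (1 - s * t) := by
    have := sub_pos.2 hst
    positivity
  linarith

lemma continuousOn_kleinT (hr : α ^ 2 + β ^ 2 < 1) :
    ContinuousOn (kleinT α β) (Icc (-1 : ℝ) 1) := by
  have hc : Continuous (kleinD α β) := by unfold kleinD; fun_prop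
  exact (by fun_prop : ContinuousOn (fun t : ℝ => 2 * t) _).div hc.continuousOn
    fun t ht => (kleinD_pos hr ht).ne'

/-- In the Klein model, geodesics are straight. -/
lemma toKlein_geo (hv : v 0 ^ 2 + v 1 ^ 2 = 1) (hr : α ^ 2 + β ^ 2 < 1)
    (ht : t ∈ Icc (-1 : ℝ) 1) :
    toKlein (geo v α β t) = toKlein (geo v α β 0) + kleinT α β t •
      (((1 - (α ^ 2 + β ^ 2)) / (1 + (α ^ 2 + β ^ 2))) •
        ((v 0 * (1 - α ^ 2 + β ^ 2) - v 1 * (2 * α * β)) • ex +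
          (v 0 * (2 * α * β) + v 1 * (1 - α ^ 2 + β ^ 2)) • ey)) := by
  have hD := geoD_pos hr ht
  have hK := kleinD_pos hr ht
  have hr1 : 0 < 1 + (α ^ 2 + β ^ 2) := by positivity
  have e : ∀ s ∈ Icc (-1 : ℝ) 1, 2 / (1 + ‖geo v α β s‖ ^ 2) = 2 * geoD α β s / kleinD α β s := by
    intro s hs
    have hD := geoD_pos hr hs
    have hK := kleinD_pos hr hs
    have : 1 + ‖geo v α β s‖ ^ 2 = kleinD α β s / geoD α β s := by
      have h1 := one_sub_geo hD.ne'
      rw [norm_sq_coord, norm_sq_geo hv]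
      rw [eq_div_iff hD.ne'] at h1 ⊢
      rw [kleinD]
      rw [geoD] at h1 ⊢
      linarith
    rw [this]
    field_simp
  have h0 : (0 : ℝ) ∈ Icc (-1 : ℝ) 1 := by simp
  rw [toKlein, toKlein, e t ht, e 0 h0]
  have kA : geoA α β t * geoD α β t = (α + t) * (1 + t * α) - t * β ^ 2 := by
    rw [geoA]; field_simp
  have kB : geoB α β t * geoD α β t = -(β * (1 + 2 * t * α + t ^ 2)) := by
    rw [geoB]; field_simp
  have z1 : geoD α β 0 = 1 := by simp [geoD]
  have z2 : geoA α β 0 = α := by simp [geoA, z1]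
  have z3 : geoB α β 0 = -β := by simp [geoB, z1]
  have z4 : kleinD α β 0 = 1 + (α ^ 2 + β ^ 2) := by simp [kleinD]
  have mA : 2 * geoD α β t / kleinD α β t * geoA α β t = 2 * 1 / (1 + (α ^ 2 + β ^ 2)) * α +
      kleinT α β t * ((1 - (α ^ 2 + β ^ 2)) / (1 + (α ^ 2 + β ^ 2)) * (1 - α ^ 2 + β ^ 2)) := by
    have : 2 * geoD α β t / kleinD α β t * geoA α β t =
      2 * (geoA α β t * geoD α β t) / kleinD α β t := by ring
    rw [this, kA, kleinT]
    field_simp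
    rw [kleinD]; ring
  have mB : 2 * geoD α β t / kleinD α β t * geoB α β t = 2 * 1 / (1 + (α ^ 2 + β ^ 2)) * (-β) +
      kleinT α β t * ((1 - (α ^ 2 + β ^ 2)) / (1 + (α ^ 2 + β ^ 2)) * (2 * α * β)) := by
    have : 2 * geoD α β t / kleinD α β t * geoB α β t =
      2 * (geoB α β t * geoD α β t) / kleinD α β t := by ring
    rw [this, kB, kleinT]
    field_simp
    rw [kleinD]; ring
  apply eq_of_coord
  · simp only [geo, PiLp.add_apply, PiLp.smul_apply, ex_zero, ey_zero,
      smul_eq_mul, mul_one, mul_zero, add_zero, z1, z2, z3, z4]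
    linear_combination v 0 * mA - v 1 * mB
  · simp only [geo, PiLp.add_apply, PiLp.smul_apply, ex_one, ey_one,
      smul_eq_mul, mul_one, mul_zero, zero_add, z1, z2, z3, z4]
    linear_combination v 0 * mB + v 1 * mA

lemma toKlein_injOn : InjOn toKlein {z : E2 | ‖z‖ ≤ 1} := by
  intro z hz w hw h
  have hz1 : ‖z‖ ≤ 1 := hz
  have hw1 : ‖w‖ ≤ 1 := hw
  have hz0 := norm_nonneg z
  have hw0 := norm_nonneg w
  have hn : ‖z‖ = ‖w‖ := by
    have := congrArg norm h
    rw [toKlein, toKlein, norm_smul, norm_smul, Real.norm_of_nonneg (by positivity),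
      Real.norm_of_nonneg (by positivity)] at this
    field_simp at this
    have h2 : (‖z‖ - ‖w‖) * (1 - ‖z‖ * ‖w‖) = 0 := by linarith
    rcases mul_eq_zero.1 h2 with h3 | h3
    · linarith
    · nlinarith
  rw [toKlein, toKlein, hn] at h
  exact smul_right_injective E2 (by positivity : 2 / (1 + ‖w‖ ^ 2) ≠ 0) h

lemma norm_geo_lt (hv : v 0 ^ 2 + v 1 ^ 2 = 1) (hr : α ^ 2 + β ^ 2 < 1)
    (ht : t ∈ Ioo (-1 : ℝ) 1) : ‖geo v α β t‖ < 1 := by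
  have hD := geoD_pos hr ⟨ht.1.le, ht.2.le⟩
  have h1 := one_sub_geo hD.ne'
  rw [← norm_sq_geo hv, ← norm_sq_coord] at h1
  have h2 : 0 < 1 - t ^ 2 := by nlinarith [ht.1, ht.2]
  have h3 : 0 < 1 - (α ^ 2 + β ^ 2) := by linarith
  have : 0 < (1 - (α ^ 2 + β ^ 2)) * (1 - t ^ 2) / geoD α β t := by positivity
  have : ‖geo v α β t‖ ^ 2 < 1 := by linarith
  exact (sq_lt_one_iff₀ (norm_nonneg _)).1 this

lemma norm_geo_eq (hv : v 0 ^ 2 + v 1 ^ 2 = 1) (hr : α ^ 2 + β ^ 2 < 1) (ht : t ^ 2 = 1) :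
    ‖geo v α β t‖ = 1 := by
  have ht' : t ∈ Icc (-1 : ℝ) 1 := abs_le.1 (sq_le_one_iff_abs_le_one t |>.1 ht.le)
  have h1 := one_sub_geo (geoD_pos hr ht').ne'
  rw [← norm_sq_geo hv, ← norm_sq_coord, ht] at h1
  have : ‖geo v α β t‖ ^ 2 = 1 := by
    rw [sub_self, mul_zero, zero_div] at h1; linarith
  exact (pow_eq_one_iff_of_nonneg (norm_nonneg _) two_ne_zero).1 this

lemma norm_geo_le (hv : v 0 ^ 2 + v 1 ^ 2 = 1) (hr : α ^ 2 + β ^ 2 < 1)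
    (ht : t ∈ Icc (-1 : ℝ) 1) : ‖geo v α β t‖ ≤ 1 := by
  rcases eq_or_lt_of_le ht.1 with h | h
  · exact (norm_geo_eq hv hr (by rw [← h]; norm_num)).le
  rcases eq_or_lt_of_le ht.2 with h' | h'
  · exact (norm_geo_eq hv hr (by rw [h']; norm_num)).le
  exact (norm_geo_lt hv hr ⟨h, h'⟩).le

lemma geo_injOn (hv : v 0 ^ 2 + v 1 ^ 2 = 1) (hr : α ^ 2 + β ^ 2 < 1) :
    InjOn (geo v α β) (Icc (-1 : ℝ) 1) := by
  intro s hs t ht h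
  have hk := congrArg toKlein h
  rw [toKlein_geo hv hr hs, toKlein_geo hv hr ht] at hk
  have h1 := add_left_cancel hk
  refine (kleinT_strictMonoOn hr).injOn hs ht (smul_left_injective ℝ ?_ h1)
  intro h0
  have h3 : (1 - (α ^ 2 + β ^ 2)) / (1 + (α ^ 2 + β ^ 2)) ≠ 0 :=
    div_ne_zero (by linarith) (by positivity)
  have h4 := (smul_eq_zero.1 h0).resolve_left h3
  have e0 := congrArg (fun w : E2 => w 0) h4
  have e1 := congrArg (fun w : E2 => w 1) h4
  simp at e0 e1
  have : 1 - α ^ 2 + β ^ 2 = 0 := by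
    linear_combination v 0 * e0 + v 1 * e1 - (1 - α ^ 2 + β ^ 2) * hv
  nlinarith [sq_nonneg β]

/-- The geodesic arc between two points of `geo` is the corresponding part of the curve. -/
lemma geodArc_geo (hv : v 0 ^ 2 + v 1 ^ 2 = 1) (hr : α ^ 2 + β ^ 2 < 1) {a b : ℝ}
    (ha : -1 ≤ a) (hab : a < b) (hb : b ≤ 1) :
    geodArc (geo v α β a) (geo v α β b) \ {geo v α β a, geo v α β b} = geo v α β '' Ioo a b := by
  have hsub : Icc a b ⊆ Icc (-1) 1 := Icc_subset_Icc ha hb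
  have ha' : a ∈ Icc (-1 : ℝ) 1 := hsub ⟨le_rfl, hab.le⟩
  have hb' : b ∈ Icc (-1 : ℝ) 1 := hsub ⟨hab.le, le_rfl⟩
  have hmono := kleinT_strictMonoOn hr
  ext z
  constructor
  · rintro ⟨⟨hz, s, hs, hk⟩, hne⟩
    have hm : (1 - s) * kleinT α β a + s * kleinT α β b ∈ Icc (kleinT α β a) (kleinT α β b) := by
      have := hmono ha' hb' hab
      constructor <;> nlinarith [hs.1, hs.2]
    obtain ⟨t, ht, hte⟩ := intermediate_value_Icc hab.le ((continuousOn_kleinT hr).mono hsub) hm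
    have hzt : z = geo v α β t := by
      refine toKlein_injOn (show ‖z‖ ≤ 1 from LT.lt.le hz) (norm_geo_le hv hr (hsub ht)) ?_
      rw [hk, toKlein_geo hv hr ha', toKlein_geo hv hr hb', toKlein_geo hv hr (hsub ht), hte]
      module
    have hta : t ≠ a := fun h => hne (by simp [hzt, h])
    have htb : t ≠ b := fun h => hne (by simp [hzt, h])
    exact ⟨t, ⟨lt_of_le_of_ne ht.1 hta.symm, lt_of_le_of_ne ht.2 htb⟩, hzt.symm⟩
  · rintro ⟨t, ht, rfl⟩
    have ht' : t ∈ Icc (-1 : ℝ) 1 := hsub ⟨ht.1.le, ht.2.le⟩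
    have h1 := hmono ha' ht' ht.1
    have h2 := hmono ht' hb' ht.2
    refine ⟨⟨norm_geo_lt hv hr ⟨ha.trans_lt ht.1, ht.2.trans_le hb⟩,
      (kleinT α β t - kleinT α β a) / (kleinT α β b - kleinT α β a), ⟨?_, ?_⟩, ?_⟩, ?_⟩
    · exact div_nonneg (by linarith) (by linarith)
    · rw [div_le_one (by linarith)]; linarith
    · rw [toKlein_geo hv hr ha', toKlein_geo hv hr hb', toKlein_geo hv hr ht']
      have hne : kleinT α β b - kleinT α β a ≠ 0 := by linarith
      generalize kleinT α β b = B at *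
      generalize kleinT α β a = A at *
      generalize kleinT α β t = T at *
      have : T = (1 - (T - A) / (B - A)) * A + (T - A) / (B - A) * B := by
        field_simp
        ring
      conv_lhs => rw [this]
      module
    · simp only [mem_insert_iff, mem_singleton_iff, not_or]
      exact ⟨fun h => ht.1.ne' (geo_injOn hv hr ht' ha' h),
        fun h => ht.2.ne (geo_injOn hv hr ht' hb' h)⟩

end

/-! ### Divergence lines -/

/-- The first point at which a path leaves an open set. -/
lemma exists_first_exit {X : Type*} [TopologicalSpace X] {Ω : Set X} (hΩ : IsOpen Ω) {f : ℝ → X}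
    (hf : ContinuousOn f (Icc 0 1)) (h0 : f 0 ∈ Ω) (h1 : f 1 ∉ Ω) :
    ∃ T ∈ Ioc (0 : ℝ) 1, f T ∈ frontier Ω ∧ ∀ t ∈ Ico 0 T, f t ∈ Ω := by
  set S : Set ℝ := Icc 0 1 ∩ f ⁻¹' Ωᶜ with hS
  have hcl : IsClosed S := hf.preimage_isClosed_of_isClosed isClosed_Icc hΩ.isClosed_compl
  have hbdd : BddBelow S := ⟨0, fun t ht => ht.1.1⟩
  obtain ⟨hT, hTn⟩ := hcl.csInf_mem ⟨1, ⟨zero_le_one, le_rfl⟩, h1⟩ hbdd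
  set T := sInf S with hTdef
  have hpos : 0 < T := by
    refine lt_of_le_of_ne hT.1 fun h => hTn ?_
    rwa [← h]
  have hin : ∀ t ∈ Ico 0 T, f t ∈ Ω := by
    intro t ht
    by_contra h
    exact absurd (csInf_le hbdd (show t ∈ S from ⟨⟨ht.1, ht.2.le.trans hT.2⟩, h⟩)) (not_le.2 ht.2)
  refine ⟨T, ⟨hpos, hT.2⟩, ?_, hin⟩
  rw [hΩ.frontier_eq]
  refine ⟨?_, hTn⟩
  have hc : ContinuousWithinAt f (Ico 0 T) T :=
    (hf T hT).mono fun t ht => ⟨ht.1, ht.2.le.trans hT.2⟩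
  refine hc.mem_closure ?_ hin
  rw [closure_Ico hpos.ne]
  exact ⟨hpos.le, le_rfl⟩

/-- Through every point of the divergence set passes a divergence line. -/
lemma exists_divergence_line {Ω : Set E2} {u : ℕ → E2 → ℝ} (hΩ : IsOpen Ω) (hΩD : Ω ⊆ Disk)
    (hu : ∀ k, IsMinimalGraph Ω (u k)) {p : E2} (hp : p ∈ DivergenceSet Ω u) :
    ∃ x y : E2, x ≠ y ∧ x ∈ frontier Ω ∧ y ∈ frontier Ω ∧
      Ω ∩ closure (geodArc x y \ {x, y}) ⊆ geodArc x y \ {x, y} ∧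
      p ∈ geodArc x y \ {x, y} ∧ geodArc x y \ {x, y} ⊆ DivergenceSet Ω u := by
  obtain ⟨m, hm, hsteep⟩ := exists_steep hΩD hp
  have hpΩ : p ∈ Ω := hp.1
  have hpD : p 0 ^ 2 + p 1 ^ 2 < 1 := by
    rw [← norm_sq_coord]
    exact (sq_lt_one_iff₀ (norm_nonneg _)).2 (hΩD hpΩ)
  obtain ⟨v, hv0, hv1⟩ : ∃ v : E2, v 0 = -m 1 ∧ v 1 = m 0 := ⟨rot m, rot_zero m, rot_one m⟩
  have hv : v 0 ^ 2 + v 1 ^ 2 = 1 := by rw [hv0, hv1]; linarith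
  obtain ⟨α, hα⟩ : ∃ α, α = p 0 * v 0 + p 1 * v 1 := ⟨_, rfl⟩
  obtain ⟨β, hβ⟩ : ∃ β, β = p 0 * v 1 - p 1 * v 0 := ⟨_, rfl⟩
  have hr : α ^ 2 + β ^ 2 < 1 := by
    have : α ^ 2 + β ^ 2 = p 0 ^ 2 + p 1 ^ 2 := by
      rw [hα, hβ]; linear_combination (p 0 ^ 2 + p 1 ^ 2) * hv
    rwa [this]
  have hg0 : geo v α β 0 = p := by
    apply eq_of_coord <;> simp [geo, geoA, geoB, geoD, hα, hβ]
    · linear_combination p 0 * hv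
    · linear_combination p 1 * hv
  have hn0 : geoNormal v α β 0 = m := by
    apply eq_of_coord <;> simp [geoNormal, dirA, dirB, geoD, hv0, hv1]
  have hmem : ∀ t, geo v α β t ∈ Ω → t ^ 2 ≠ 1 := fun t h ht =>
    (show ‖geo v α β t‖ < 1 from hΩD h).ne (norm_geo_eq hv hr ht)
  obtain ⟨b, ⟨hb0, hb1⟩, hbf, hbΩ⟩ := exists_first_exit hΩ (f := geo v α β)
    (fun t ht => (continuousAt_geo hr ⟨by linarith [ht.1], ht.2⟩).continuousWithinAt)
    (by rwa [hg0]) fun h => hmem 1 h (by norm_num)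
  obtain ⟨a, ⟨ha0, ha1⟩, haf, haΩ⟩ := exists_first_exit hΩ (f := fun t => geo v α β (-t))
    (fun t ht => ((continuousAt_geo hr
      ⟨by linarith [ht.2], by linarith [ht.1]⟩).comp continuousAt_neg).continuousWithinAt)
    (by rwa [neg_zero, hg0]) fun h => hmem (-1) h (by norm_num)
  have hab : -a < b := by linarith
  have ha1' : -1 ≤ -a := by linarith
  have harc := geodArc_geo hv hr ha1' hab hb1
  have hnot : ∀ x ∈ frontier Ω, x ∉ Ω := fun x hx => by
    rw [hΩ.frontier_eq] at hx; exact hx.2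
  refine ⟨geo v α β (-a), geo v α β b, fun h => ?_, haf, hbf, ?_, ?_, ?_⟩
  · exact hab.ne (geo_injOn hv hr ⟨ha1', by linarith⟩ ⟨by linarith, hb1⟩ h)
  · rw [harc]
    rintro z ⟨hzΩ, hz⟩
    have hcomp : IsClosed (geo v α β '' Icc (-a) b) := by
      refine (isCompact_Icc.image_of_continuousOn fun t ht => ?_).isClosed
      exact (continuousAt_geo hr ⟨by linarith [ht.1], by linarith [ht.2]⟩).continuousWithinAt
    obtain ⟨t, ht, rfl⟩ := closure_minimal (image_mono Ioo_subset_Icc_self) hcomp hz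
    refine ⟨t, ⟨lt_of_le_of_ne ht.1 ?_, lt_of_le_of_ne ht.2 ?_⟩, rfl⟩
    · rintro rfl; exact hnot _ haf hzΩ
    · rintro rfl; exact hnot _ hbf hzΩ
  · rw [harc]
    exact ⟨0, ⟨by linarith, hb0⟩, hg0⟩
  · rw [harc]
    rintro _ ⟨τ, ⟨hτa, hτb⟩, rfl⟩
    have hκ : ∀ s t : ℝ, 0 ≤ t → t ≤ s → s < 1 → |2 / (1 - t ^ 2)| ≤ 2 / (1 - s ^ 2) := by
      intro s t h0 hts hs
      have hs2 : 0 < 1 - s ^ 2 := by nlinarith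
      have hle : 1 - s ^ 2 ≤ 1 - t ^ 2 := by nlinarith
      rw [abs_of_nonneg (div_nonneg zero_le_two (hs2.le.trans hle))]
      gcongr
    rcases le_total 0 τ with h | h
    · have hτ1 : τ < 1 := hτb.trans_le hb1
      have hg : ∀ t ∈ Icc 0 τ, GeodAt (geo v α β) (geoNormal v α β) (2 / (1 - t ^ 2)) t :=
        fun t ht => geodAt_geo hv hr ⟨by linarith [ht.1], by linarith [ht.2]⟩
      have := Steep.propagate hu hΩ hΩD h hg (fun t ht => hκ τ t ht.1 ht.2 hτ1)
        (fun t ht => hbΩ t ⟨ht.1, ht.2.trans_lt hτb⟩) (by rwa [hg0, hn0])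
      exact this.mem_divergenceSet hΩD (hbΩ τ ⟨h, hτb⟩) (hg τ ⟨h, le_rfl⟩).unit
    · have hτ1 : -τ < 1 := by linarith
      have hg : ∀ t ∈ Icc 0 (-τ), GeodAt (fun s => geo v α β (-s)) (fun s => geoNormal v α β (-s))
          (-(2 / (1 - t ^ 2))) t := fun t ht => by
        have := geodAt_geo (t := -t) hv hr ⟨by linarith [ht.2], by linarith [ht.1]⟩
        rw [neg_sq] at this
        exact this.comp_neg
      have := Steep.propagate hu hΩ hΩD (neg_nonneg.2 h) hg
        (fun t ht => by rw [abs_neg]; exact hκ (-τ) t ht.1 ht.2 hτ1)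
        (fun t ht => haΩ t ⟨ht.1, by linarith [ht.2]⟩) (by rwa [neg_zero, hg0, hn0])
      have hfin := this.mem_divergenceSet hΩD (haΩ (-τ) ⟨neg_nonneg.2 h, by linarith⟩)
        (hg (-τ) ⟨neg_nonneg.2 h, le_rfl⟩).unit
      rwa [neg_neg] at hfin

/-- **Structure of the divergence set** (Proposition `prop:div` 1): the divergence set
of a sequence of minimal graphs on `Ω` is a union of geodesic arcs contained in `Ω`
(divergence lines), each closed as a subset of `Ω`, whose endpoints lie on
`∂Ω ∪ ∂∞𝔻` (possibly at vertices or ideal points). -/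
theorem divergence_set_is_union_of_geodesics (Ω : Set E2) (hΩ : IsOpen Ω)
    (hconn : IsConnected Ω) (hΩD : Ω ⊆ Disk)
    (u : ℕ → E2 → ℝ) (hu : ∀ k, IsMinimalGraph Ω (u k)) :
    ∃ I : Set (E2 × E2),
      (∀ e ∈ I, e.1 ≠ e.2 ∧
        e.1 ∈ frontier Ω ∪ {x : E2 | ‖x‖ = 1} ∧
        e.2 ∈ frontier Ω ∪ {x : E2 | ‖x‖ = 1} ∧
        geodArc e.1 e.2 \ {e.1, e.2} ⊆ Ω ∧
        -- the line is closed as a subset of Ω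
        Ω ∩ closure (geodArc e.1 e.2 \ {e.1, e.2}) ⊆ geodArc e.1 e.2 \ {e.1, e.2}) ∧
      DivergenceSet Ω u = ⋃ e ∈ I, geodArc e.1 e.2 \ {e.1, e.2} := by
  refine ⟨{e | e.1 ≠ e.2 ∧ e.1 ∈ frontier Ω ∧ e.2 ∈ frontier Ω ∧
    Ω ∩ closure (geodArc e.1 e.2 \ {e.1, e.2}) ⊆ geodArc e.1 e.2 \ {e.1, e.2} ∧
    geodArc e.1 e.2 \ {e.1, e.2} ⊆ DivergenceSet Ω u}, ?_, ?_⟩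
  · rintro e ⟨hne, h1, h2, hcl, hsub⟩
    exact ⟨hne, Or.inl h1, Or.inl h2, fun z hz => (hsub hz).1, hcl⟩
  · refine Subset.antisymm (fun p hp => ?_) (iUnion₂_subset fun e he => he.2.2.2.2)
    obtain ⟨x, y, hne, hx, hy, hcl, hmem, hsub⟩ := exists_divergence_line hΩ hΩD hu hp
    exact mem_iUnion₂.2 ⟨(x, y), ⟨hne, hx, hy, hcl, hsub⟩, hmem⟩

end
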